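/- Assume N = 3 and that χ_σ is regular, i.e. χ_σ^ω ≠ χ_σ for every ω ∈ W_0 with ω ≠ Id. Then for every (a_1,a_2) ∈ S_{Id}: (1) f_{Id,(a_1,a_2)}|T_{t_{(−1,0)}} = f_{Id,(a_1−1,a_2)} and f_{Id,(a_1,a_2)}|T_{t_{(−1,−1)}} = f_{Id,(a_1−1,a_2−1)}; (2) f_{Id,(a_1,a_2)}|T = 0 for each T ∈ {T_{t_{(1,0)}}, T_{t_{(0,1)}}, T_{t_{(0,−1)}}, T_{t_{(1,1)}}}. -/

import Mathlib

open Matrix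

noncomputable section

namespace IH

variable (p : ℕ) [Fact p.Prime]

/-- `\bar{𝔽}_p`, an algebraic closure of the residue field. -/
abbrev kb := AlgebraicClosure (ZMod p)

variable (N : ℕ)

/-- `G = GL_N(F)` with `F = ℚ_p`. -/
abbrev GG := GL (Fin N) ℚ_[p]
/-- `GL_N(O_F)` (as an abstract group, mapping onto `K ⊆ G`). -/
abbrev MM := GL (Fin N) ℤ_[p]
/-- `GL_N(k_F)`. -/
abbrev Gk := GL (Fin N) (ZMod p)

/-- The inclusion `GL_N(O_F) → GL_N(F)`. -/
def iotaM : MM p N →* GG p N := Matrix.GeneralLinearGroup.map (PadicInt.Coe.ringHom)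

/-- The reduction map `red : GL_N(O_F) → GL_N(k_F)`. -/
def redM : MM p N →* Gk p N := Matrix.GeneralLinearGroup.map (PadicInt.toZMod)

/-- Elements of `GL_N(O_F)` whose reduction is upper triangular: the Iwahori condition. -/
def Ipre : Set (MM p N) :=
  {m | ∀ i j : Fin N, j < i → ((redM p N m : Matrix (Fin N) (Fin N) (ZMod p)) i j = 0)}

/-- Elements of `GL_N(O_F)` whose reduction is upper triangular unipotent: pro-p Iwahori. -/
def I1pre : Set (MM p N) :=
  {m | m ∈ Ipre p N ∧ ∀ i : Fin N, ((redM p N m : Matrix (Fin N) (Fin N) (ZMod p)) i i = 1)}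

/-- Elements of `GL_N(O_F)` reducing to the identity: `K_1 = ker red`. -/
def K1pre : Set (MM p N) := {m | redM p N m = 1}

/-- `K = GL_N(O_F)` as a subset of `G`. -/
def Kset : Set (GG p N) := Set.range (iotaM p N)
/-- The Iwahori subgroup `I ⊆ G`. -/
def Iset : Set (GG p N) := iotaM p N '' Ipre p N
/-- The pro-p Iwahori subgroup `I_1 ⊆ G`. -/
def I1set : Set (GG p N) := iotaM p N '' I1pre p N
/-- `K_1 ⊆ G`. -/
def K1set : Set (GG p N) := iotaM p N '' K1pre p N

/-- The uniformizer `ϖ = p` as a unit of `ℚ_p`. -/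
def pU : ℚ_[p]ˣ :=
  Units.mk0 (p : ℚ_[p]) (by
    have h := (Fact.out : p.Prime).ne_zero
    exact_mod_cast Nat.cast_ne_zero.mpr h)

/-- Scalar matrices as elements of `G`. -/
def scalarGL (u : ℚ_[p]ˣ) : GG p N :=
  Units.map (algebraMap ℚ_[p] (Matrix (Fin N) (Fin N) ℚ_[p])).toMonoidHom u

/-- The central element `ϖ^n · Id`. -/
def piSc (n : ℤ) : GG p N := scalarGL p N (pU p ^ n)

/-- Invertible diagonal matrices. -/
def diagGL (d : Fin N → ℚ_[p]ˣ) : GG p N where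
  val := Matrix.diagonal fun i => (d i : ℚ_[p])
  inv := Matrix.diagonal fun i => (((d i)⁻¹ : ℚ_[p]ˣ) : ℚ_[p])
  val_inv := by
    rw [Matrix.diagonal_mul_diagonal]
    simp
  inv_val := by
    rw [Matrix.diagonal_mul_diagonal]
    simp

/-- extend `a ∈ ℤ^{N-1}` by `0` in the last coordinate. -/
def expo (a : Fin (N - 1) → ℤ) : Fin N → ℤ :=
  fun i => if h : (i : ℕ) < N - 1 then a ⟨i, h⟩ else 0

/-- `t_a = diag(ϖ^{a_1}, …, ϖ^{a_{N-1}}, 1)`. -/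
def tGL (a : Fin (N - 1) → ℤ) : GG p N :=
  diagGL p N fun i => pU p ^ (expo N a i)

/-- The permutation matrix of `σ` (with `permGL σ · e_j = e_{σ j}`, so that
`permGL` is a group homomorphism). -/
def permGL (σ : Equiv.Perm (Fin N)) : GG p N where
  val := (σ⁻¹).permMatrix ℚ_[p]
  inv := σ.permMatrix ℚ_[p]
  val_inv := by
    show ((σ⁻¹).toPEquiv.toMatrix : Matrix (Fin N) (Fin N) ℚ_[p]) * σ.toPEquiv.toMatrix = 1
    rw [← PEquiv.toMatrix_trans, ← Equiv.toPEquiv_trans]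
    simp only [Equiv.self_trans_symm, Equiv.symm_trans_self, Equiv.Perm.inv_def]
    rw [Equiv.toPEquiv_refl, PEquiv.toMatrix_refl]
  inv_val := by
    show (σ.toPEquiv.toMatrix : Matrix (Fin N) (Fin N) ℚ_[p]) * (σ⁻¹).toPEquiv.toMatrix = 1
    rw [← PEquiv.toMatrix_trans, ← Equiv.toPEquiv_trans]
    simp only [Equiv.self_trans_symm, Equiv.symm_trans_self, Equiv.Perm.inv_def]
    rw [Equiv.toPEquiv_refl, PEquiv.toMatrix_refl]

/-- `ω t_a`. -/
def wS (σ : Equiv.Perm (Fin N)) (a : Fin (N - 1) → ℤ) : GG p N :=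
  permGL p N σ * tGL p N a

/-- The permutation `ω₂` (as a matrix: first row block `(0, I_{N-1})`, last row `(1,0,…,0)`). -/
def w2 : Equiv.Perm (Fin N) := (finRotate N)⁻¹

/-- `γ = ω₂ · diag(ϖ, I_{N-1})`. -/
def gammaGL : GG p N :=
  permGL p N (w2 N) * tGL p N fun i => if (i : ℕ) = 0 then 1 else 0

/-- `S_ω = {a ∈ ℤ^{N-1} : (ω t_a) I (ω t_a)⁻¹ ∩ K ⊆ I}`. -/
def Sset (σ : Equiv.Perm (Fin N)) : Set (Fin (N - 1) → ℤ) :=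
  {a | ∀ g ∈ Iset p N,
    wS p N σ a * g * (wS p N σ a)⁻¹ ∈ Kset p N →
    wS p N σ a * g * (wS p N σ a)⁻¹ ∈ Iset p N}

/-- The unit of `k_F^×` attached to a nonzero element of `k_F` (junk value `1` at `0`). -/
def unitOf (x : ZMod p) : (ZMod p)ˣ :=
  if h : x = 0 then 1 else Units.mk0 x h

/-- The diagonal of the reduction of `m`, as an `N`-tuple of units of `k_F`. -/
def diagOf (m : MM p N) : Fin N → (ZMod p)ˣ :=
  fun i => unitOf p ((redM p N m : Matrix (Fin N) (Fin N) (ZMod p)) i i)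

/-- The transformation rule for functions in `H_{IZ}(χ)`, where the character `χ` of `I`
is given by the character `ξ` of the torus `(k_F^×)^N` through the diagonal of the
reduction, extended to `IZ` by `χ(ϖ) = 1`. -/
def HTransf (ξ : (Fin N → (ZMod p)ˣ) →* (kb p)ˣ) (φ : GG p N → kb p) : Prop :=
  ∀ (n₁ n₂ : ℤ) (m₁ m₂ : MM p N), m₁ ∈ Ipre p N → m₂ ∈ Ipre p N → ∀ g : GG p N,
    φ (piSc p N n₁ * iotaM p N m₁ * g * (piSc p N n₂ * iotaM p N m₂)) =
      (ξ (diagOf p N m₁) : kb p) * (ξ (diagOf p N m₂) : kb p) * φ g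

/-- `φ` is supported on the double coset `IZ x I`. -/
def SuppDouble (φ : GG p N → kb p) (x : GG p N) : Prop :=
  ∀ g : GG p N, φ g ≠ 0 → ∃ (n : ℤ) (m₁ m₂ : MM p N), m₁ ∈ Ipre p N ∧ m₂ ∈ Ipre p N ∧
    g = piSc p N n * iotaM p N m₁ * x * iotaM p N m₂

/-- Membership in `H_{IZ}(χ)`: the transformation rule together with support in
finitely many double cosets `IZ g I`. -/
def HMem (ξ : (Fin N → (ZMod p)ˣ) →* (kb p)ˣ) (φ : GG p N → kb p) : Prop :=
  HTransf p N ξ φ ∧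
  ∃ S : Finset (GG p N), ∀ g : GG p N, φ g ≠ 0 →
    ∃ s ∈ S, ∃ (n : ℤ) (m₁ m₂ : MM p N), m₁ ∈ Ipre p N ∧ m₂ ∈ Ipre p N ∧
      g = piSc p N n * iotaM p N m₁ * s * iotaM p N m₂

section Rep

variable {V : Type} [AddCommGroup V] [Module (kb p) V]

/-- `σ` (here `ρ`) is irreducible. -/
def IsIrred (ρ : Representation (kb p) (Gk p N) V) : Prop :=
  (∃ v : V, v ≠ 0) ∧
  ∀ W : Submodule (kb p) V, (∀ g v, v ∈ W → ρ g v ∈ W) → W = ⊥ ∨ W = ⊤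

/-- Membership in the compact induction `ind_{KZ}^G σ`: left `KZ`-equivariance
(where `ϖ` acts trivially), support in finitely many cosets `KZ g`, and smoothness. -/
def IndMem (ρ : Representation (kb p) (Gk p N) V) (f : GG p N → V) : Prop :=
  (∀ (n : ℤ) (m : MM p N) (g : GG p N),
      f (piSc p N n * iotaM p N m * g) = ρ (redM p N m) (f g)) ∧
  (∃ S : Finset (GG p N), ∀ g : GG p N, f g ≠ 0 →
      ∃ s ∈ S, ∃ (n : ℤ) (m : MM p N), g = piSc p N n * iotaM p N m * s) ∧
  (∃ U : Subgroup (GG p N), IsOpen (U : Set (GG p N)) ∧ ∀ u ∈ U, ∀ g, f (g * u) = f g)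

/-- `f` is invariant under right translation by `I_1`. -/
def IsI1Inv (f : GG p N → V) : Prop :=
  ∀ u ∈ I1set p N, ∀ g, f (g * u) = f g

/-- The defining property of the standard function `f_{ω,a}`: an `I_1`-invariant member of
`ind_{KZ}^G σ` supported on `KZ t_a I_1` with value `v₀` at `ω t_a`. -/
def IsStd (ρ : Representation (kb p) (Gk p N) V) (v₀ : V)
    (σp : Equiv.Perm (Fin N)) (a : Fin (N - 1) → ℤ) (f : GG p N → V) : Prop :=
  IndMem p N ρ f ∧ IsI1Inv p N f ∧
  (∀ g : GG p N, f g ≠ 0 → ∃ (n : ℤ) (m : MM p N) (u : GG p N), u ∈ I1set p N ∧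
      g = piSc p N n * iotaM p N m * tGL p N a * u) ∧
  f (wS p N σp a) = v₀

/-- `R` is a set of representatives for `I_1/(I_1 ∩ g⁻¹ I_1 g)`. -/
def IsRepSet (g : GG p N) (R : Finset (GG p N)) : Prop :=
  (↑R ⊆ I1set p N) ∧
  ∀ x ∈ I1set p N, ∃! r : GG p N, r ∈ R ∧
    (r⁻¹ * x ∈ I1set p N ∧ g * (r⁻¹ * x) * g⁻¹ ∈ I1set p N)

/-- The Hecke operator: `f|T_g = ∑_{r} (r g⁻¹)·f`, where `(h·f)(x) = f(xh)`. -/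
def hk (g : GG p N) (R : Finset (GG p N)) (f : GG p N → V) : GG p N → V :=
  fun x => ∑ r ∈ R, f (x * r * g⁻¹)

end Rep

section FiniteGroup

variable {p}

/-- The upper unipotent matrices of size three. -/
def upperU {R : Type*} [CommRing R] (a b c : R) : GL (Fin 3) R where
  val := !![1, a, b; 0, 1, c; 0, 0, 1]
  inv := !![1, -a, a * c - b; 0, 1, -c; 0, 0, 1]
  val_inv := by
    ext i j
    fin_cases i <;> fin_cases j <;> simp [Matrix.mul_apply, Fin.sum_univ_three]
    ring
  inv_val := by
    ext i j
    fin_cases i <;> fin_cases j <;> simp [Matrix.mul_apply, Fin.sum_univ_three]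
    ring

/-- The lower unipotent matrices of size three. -/
def lowerU {R : Type*} [CommRing R] (a b c : R) : GL (Fin 3) R where
  val := !![1, 0, 0; a, 1, 0; b, c, 1]
  inv := !![1, 0, 0; -a, 1, 0; a * c - b, -c, 1]
  val_inv := by
    ext i j
    fin_cases i <;> fin_cases j <;> simp [Matrix.mul_apply, Fin.sum_univ_three]
    ring
  inv_val := by
    ext i j
    fin_cases i <;> fin_cases j <;> simp [Matrix.mul_apply, Fin.sum_univ_three]
    ring

/-- The diagonal matrix with given unit entries. -/
def torus {R : Type*} [CommRing R] (d : Fin 3 → Rˣ) : GL (Fin 3) R where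
  val := Matrix.diagonal fun i => (d i : R)
  inv := Matrix.diagonal fun i => ((d i)⁻¹ : Rˣ)
  val_inv := by simp
  inv_val := by simp

/-- The product of an element of the first simple root group and the first simple reflection. -/
def refl1 {R : Type*} [CommRing R] (x : R) : GL (Fin 3) R where
  val := !![x, 1, 0; 1, 0, 0; 0, 0, 1]
  inv := !![0, 1, 0; 1, -x, 0; 0, 0, 1]
  val_inv := by
    ext i j
    fin_cases i <;> fin_cases j <;> simp [Matrix.mul_apply, Fin.sum_univ_three]
  inv_val := by
    ext i j
    fin_cases i <;> fin_cases j <;> simp [Matrix.mul_apply, Fin.sum_univ_three]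

/-- The product of an element of the second simple root group and the second simple
reflection. -/
def refl2 {R : Type*} [CommRing R] (x : R) : GL (Fin 3) R where
  val := !![1, 0, 0; 0, x, 1; 0, 1, 0]
  inv := !![1, 0, 0; 0, 0, 1; 0, 1, -x]
  val_inv := by
    ext i j
    fin_cases i <;> fin_cases j <;> simp [Matrix.mul_apply, Fin.sum_univ_three]
  inv_val := by
    ext i j
    fin_cases i <;> fin_cases j <;> simp [Matrix.mul_apply, Fin.sum_univ_three]

section Relations

variable {R : Type*} [CommRing R]

lemma lowerU_mul (a b c a' b' c' : R) :
    lowerU a b c * lowerU a' b' c' = lowerU (a + a') (b + c * a' + b') (c + c') := by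
  ext i j
  fin_cases i <;> fin_cases j <;>
    simp [lowerU, Matrix.mul_apply, Fin.sum_univ_three]

lemma lowerU_zero : lowerU (0 : R) 0 0 = 1 := by
  ext i j
  fin_cases i <;> fin_cases j <;> simp [lowerU]

lemma torus_mul_lowerU (d : Fin 3 → Rˣ) (a b c : R) :
    torus d * lowerU a b c =
      lowerU (d 1 * a * (d 0)⁻¹ : R) (d 2 * b * (d 0)⁻¹ : R) (d 2 * c * (d 1)⁻¹ : R) *
        torus d := by
  ext i j
  fin_cases i <;> fin_cases j <;>
    simp [lowerU, torus, Matrix.mul_apply, Fin.sum_univ_three]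

lemma upperU_mul_refl1 (a b c x : R) :
    upperU a b c * refl1 x = refl1 (x + a) * upperU 0 c (b - (x + a) * c) := by
  ext i j
  fin_cases i <;> fin_cases j <;>
    simp [upperU, refl1, Matrix.mul_apply, Fin.sum_univ_three]

lemma upperU_mul_refl2 (a b c x : R) :
    upperU a b c * refl2 x = refl2 (x + c) * upperU (a * x + b) a 0 := by
  ext i j
  fin_cases i <;> fin_cases j <;>
    simp [upperU, refl2, Matrix.mul_apply, Fin.sum_univ_three, add_comm]

lemma torus_mul_refl1 (d : Fin 3 → Rˣ) (x : R) :
    torus d * refl1 x = refl1 (d 0 * x * (d 1)⁻¹ : R) * torus (d ∘ Equiv.swap 0 1) := by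
  ext i j
  fin_cases i <;> fin_cases j <;>
    simp [torus, refl1, Matrix.mul_apply, Fin.sum_univ_three, Equiv.swap_apply_def]

lemma torus_mul_refl2 (d : Fin 3 → Rˣ) (x : R) :
    torus d * refl2 x = refl2 (d 1 * x * (d 2)⁻¹ : R) * torus (d ∘ Equiv.swap 1 2) := by
  ext i j
  fin_cases i <;> fin_cases j <;>
    simp [torus, refl2, Matrix.mul_apply, Fin.sum_univ_three, Equiv.swap_apply_def]

lemma refl_braid (x y z : R) :
    refl1 x * refl2 y * refl1 z = refl2 z * refl1 (x * z + y) * refl2 x := by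
  ext i j
  fin_cases i <;> fin_cases j <;>
    simp [refl1, refl2, Matrix.mul_apply, Fin.sum_univ_three]

lemma refl1_mul_refl1_zero (x : R) : refl1 x * refl1 0 = upperU x 0 0 := by
  ext i j
  fin_cases i <;> fin_cases j <;>
    simp [refl1, upperU, Matrix.mul_apply, Fin.sum_univ_three]

lemma refl2_mul_refl2_zero (x : R) : refl2 x * refl2 0 = upperU 0 0 x := by
  ext i j
  fin_cases i <;> fin_cases j <;>
    simp [refl2, upperU, Matrix.mul_apply, Fin.sum_univ_three]

lemma refl1_mul_refl1_unit (x : R) (y : Rˣ) :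
    refl1 x * refl1 (y : R) =
      torus ![-y⁻¹, y, 1] * refl1 (-(y * (x * y + 1)) : R) * upperU ((y⁻¹ : Rˣ) : R) 0 0 := by
  ext i j
  fin_cases i <;> fin_cases j <;>
    simp [refl1, upperU, torus, Matrix.mul_apply, Fin.sum_univ_three]
  linear_combination (-x) * y.mul_inv

lemma refl2_mul_refl2_unit (x : R) (y : Rˣ) :
    refl2 x * refl2 (y : R) =
      torus ![1, -y⁻¹, y] * refl2 (-(y * (x * y + 1)) : R) * upperU 0 0 ((y⁻¹ : Rˣ) : R) := by
  ext i j
  fin_cases i <;> fin_cases j <;>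
    simp [refl2, upperU, torus, Matrix.mul_apply, Fin.sum_univ_three]
  linear_combination (-x) * y.mul_inv

lemma refl1_unit (x : Rˣ) :
    refl1 (x : R) = lowerU ((x⁻¹ : Rˣ) : R) 0 0 * torus ![x, -x⁻¹, 1] * upperU ((x⁻¹ : Rˣ) : R) 0 0 := by
  ext i j
  fin_cases i <;> fin_cases j <;>
    simp [refl1, upperU, lowerU, torus, Matrix.vecMul_diagonal, Matrix.mul_apply, Fin.sum_univ_three]

lemma refl2_unit (x : Rˣ) :
    refl2 (x : R) = lowerU 0 0 ((x⁻¹ : Rˣ) : R) * torus ![1, x, -x⁻¹] * upperU 0 0 ((x⁻¹ : Rˣ) : R) := by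
  ext i j
  fin_cases i <;> fin_cases j <;>
    simp [refl2, upperU, lowerU, torus, Matrix.vecMul_diagonal, Matrix.mul_apply, Fin.sum_univ_three]

lemma refl1_mul_lowerU (x a b c : R) :
    refl1 x * lowerU a b c = lowerU 0 c (b - c * (x + a)) * refl1 (x + a) := by
  ext i j
  fin_cases i <;> fin_cases j <;>
    simp [refl1, lowerU, Matrix.mul_apply, Fin.sum_univ_three]

lemma refl2_mul_lowerU (x a b c : R) :
    refl2 x * lowerU a b c = lowerU (x * a + b) a 0 * refl2 (x + c) := by
  ext i j
  fin_cases i <;> fin_cases j <;>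
    simp [refl2, lowerU, Matrix.mul_apply, Fin.sum_univ_three]

end Relations

variable {V : Type} [AddCommGroup V] [Module (kb p) V]

/-- The vectors fixed by the upper unipotent matrices. -/
def UFixed (ρ : Representation (kb p) (Gk p 3) V) (w : V) : Prop :=
  ∀ a b c : ZMod p, ρ (upperU a b c) w = w

/-- The common eigenvectors of the diagonal matrices. -/
def TorusEigen (ρ : Representation (kb p) (Gk p 3) V) (w : V) : Prop :=
  ∀ d : Fin 3 → (ZMod p)ˣ, ∃ c : kb p, ρ (torus d) w = c • w

/-- The Hecke operator attached to the first simple reflection. -/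
def heckeS1 (ρ : Representation (kb p) (Gk p 3) V) : V →ₗ[kb p] V :=
  ∑ x : ZMod p, ρ (refl1 x)

/-- The Hecke operator attached to the second simple reflection. -/
def heckeS2 (ρ : Representation (kb p) (Gk p 3) V) : V →ₗ[kb p] V :=
  ∑ x : ZMod p, ρ (refl2 x)

/-- The span of the orbit of `y` under the lower unipotent matrices. -/
def lowerSpan (ρ : Representation (kb p) (Gk p 3) V) (y : V) : Submodule (kb p) V :=
  Submodule.span (kb p) {v | ∃ a b c : ZMod p, v = ρ (lowerU a b c) y}

variable {ρ : Representation (kb p) (Gk p 3) V}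

lemma rep_mul_apply (g h : Gk p 3) (v : V) : ρ (g * h) v = ρ g (ρ h v) := by
  rw [map_mul]; rfl

lemma heckeS1_apply (v : V) : heckeS1 ρ v = ∑ x : ZMod p, ρ (refl1 x) v := by
  simp [heckeS1]

lemma heckeS2_apply (v : V) : heckeS2 ρ v = ∑ x : ZMod p, ρ (refl2 x) v := by
  simp [heckeS2]

lemma UFixed.heckeS1 {w : V} (hw : UFixed ρ w) : UFixed ρ (heckeS1 ρ w) := by
  intro a b c
  rw [heckeS1_apply, map_sum]
  simp_rw [← rep_mul_apply, upperU_mul_refl1, rep_mul_apply, hw _ _ _]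
  exact Equiv.sum_comp (Equiv.addRight a) fun x => ρ (refl1 x) w

lemma UFixed.heckeS2 {w : V} (hw : UFixed ρ w) : UFixed ρ (heckeS2 ρ w) := by
  intro a b c
  rw [heckeS2_apply, map_sum]
  simp_rw [← rep_mul_apply, upperU_mul_refl2, rep_mul_apply, hw _ _ _]
  exact Equiv.sum_comp (Equiv.addRight c) fun x => ρ (refl2 x) w

lemma TorusEigen.heckeS1 {w : V} (hw : TorusEigen ρ w) : TorusEigen ρ (heckeS1 ρ w) := by
  intro d
  obtain ⟨c, hc⟩ := hw (d ∘ Equiv.swap 0 1)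
  refine ⟨c, ?_⟩
  rw [heckeS1_apply, map_sum]
  simp_rw [← rep_mul_apply, torus_mul_refl1, rep_mul_apply, hc, map_smul]
  rw [← Finset.smul_sum]
  congr 1
  exact Equiv.sum_comp ((Units.mulLeft (d 0)).trans (Units.mulRight (d 1)⁻¹))
    fun x => ρ (refl1 x) w

lemma TorusEigen.heckeS2 {w : V} (hw : TorusEigen ρ w) : TorusEigen ρ (heckeS2 ρ w) := by
  intro d
  obtain ⟨c, hc⟩ := hw (d ∘ Equiv.swap 1 2)
  refine ⟨c, ?_⟩
  rw [heckeS2_apply, map_sum]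
  simp_rw [← rep_mul_apply, torus_mul_refl2, rep_mul_apply, hc, map_smul]
  rw [← Finset.smul_sum]
  congr 1
  exact Equiv.sum_comp ((Units.mulLeft (d 1)).trans (Units.mulRight (d 2)⁻¹))
    fun x => ρ (refl2 x) w

lemma heckeS_braid (w : V) :
    heckeS1 ρ (heckeS2 ρ (heckeS1 ρ w)) = heckeS2 ρ (heckeS1 ρ (heckeS2 ρ w)) := by
  have h1 : heckeS1 ρ (heckeS2 ρ (heckeS1 ρ w)) =
      ∑ x : ZMod p, ∑ z : ZMod p, ∑ y : ZMod p, ρ (refl1 x * refl2 y * refl1 z) w := by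
    simp_rw [heckeS1_apply, heckeS2_apply, map_sum, rep_mul_apply]
    exact Finset.sum_congr rfl fun x _ => Finset.sum_comm
  have h2 : heckeS2 ρ (heckeS1 ρ (heckeS2 ρ w)) =
      ∑ x : ZMod p, ∑ z : ZMod p, ∑ y : ZMod p, ρ (refl2 z * refl1 y * refl2 x) w := by
    simp_rw [heckeS1_apply, heckeS2_apply, map_sum, rep_mul_apply]
    refine (Finset.sum_congr rfl fun z _ => Finset.sum_comm).trans Finset.sum_comm
  rw [h1, h2]
  refine Finset.sum_congr rfl fun x _ => Finset.sum_congr rfl fun z _ => ?_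
  simp_rw [refl_braid]
  exact Equiv.sum_comp (Equiv.addLeft (x * z)) fun y => ρ (refl2 z * refl1 y * refl2 x) w

lemma card_smul_eq_zero (w : V) : (Fintype.card (ZMod p)) • w = 0 := by
  rw [ZMod.card, ← Nat.cast_smul_eq_nsmul (kb p), CharP.cast_eq_zero, zero_smul]

/-- The substitution appearing in the quadratic relation. -/
def quadEquiv (y : (ZMod p)ˣ) : ZMod p ≃ ZMod p where
  toFun x := -(y * (x * y + 1))
  invFun x := (-(x * (y⁻¹ : (ZMod p)ˣ)) - 1) * (y⁻¹ : (ZMod p)ˣ)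
  left_inv x := by
    have h := y.mul_inv
    linear_combination (x * y * (y⁻¹ : (ZMod p)ˣ) + x + (y⁻¹ : (ZMod p)ˣ)) * h
  right_inv x := by
    have h := y.mul_inv
    linear_combination (x * y * (y⁻¹ : (ZMod p)ˣ) + x + y) * h

lemma heckeS1_sq {w : V} (hw : UFixed ρ w) (ht : TorusEigen ρ w) :
    ∃ c : kb p, heckeS1 ρ (heckeS1 ρ w) = c • heckeS1 ρ w := by
  choose e he using ht.heckeS1
  have key : ∀ y : ZMod p, ∃ c : kb p, ∑ x : ZMod p, ρ (refl1 x * refl1 y) w =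
      c • heckeS1 ρ w := by
    intro y
    rcases eq_or_ne y 0 with rfl | hy
    · refine ⟨0, ?_⟩
      simp_rw [refl1_mul_refl1_zero, hw _ _ _]
      rw [Finset.sum_const, zero_smul]
      exact card_smul_eq_zero w
    · lift y to (ZMod p)ˣ using hy.isUnit
      refine ⟨e ![-y⁻¹, y, 1], ?_⟩
      simp_rw [refl1_mul_refl1_unit, rep_mul_apply, hw _ _ _]
      rw [← map_sum, ← he, heckeS1_apply]
      congr 1
      exact Equiv.sum_comp (quadEquiv y) fun x => ρ (refl1 x) w
  choose c hc using key
  refine ⟨∑ y, c y, ?_⟩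
  rw [Finset.sum_smul]
  simp_rw [← hc]
  rw [Finset.sum_comm]
  simp_rw [heckeS1_apply, map_sum, rep_mul_apply]

lemma heckeS2_sq {w : V} (hw : UFixed ρ w) (ht : TorusEigen ρ w) :
    ∃ c : kb p, heckeS2 ρ (heckeS2 ρ w) = c • heckeS2 ρ w := by
  choose e he using ht.heckeS2
  have key : ∀ y : ZMod p, ∃ c : kb p, ∑ x : ZMod p, ρ (refl2 x * refl2 y) w =
      c • heckeS2 ρ w := by
    intro y
    rcases eq_or_ne y 0 with rfl | hy
    · refine ⟨0, ?_⟩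
      simp_rw [refl2_mul_refl2_zero, hw _ _ _]
      rw [Finset.sum_const, zero_smul]
      exact card_smul_eq_zero w
    · lift y to (ZMod p)ˣ using hy.isUnit
      refine ⟨e ![1, -y⁻¹, y], ?_⟩
      simp_rw [refl2_mul_refl2_unit, rep_mul_apply, hw _ _ _]
      rw [← map_sum, ← he, heckeS2_apply]
      congr 1
      exact Equiv.sum_comp (quadEquiv y) fun x => ρ (refl2 x) w
  choose c hc using key
  refine ⟨∑ y, c y, ?_⟩
  rw [Finset.sum_smul]
  simp_rw [← hc]
  rw [Finset.sum_comm]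
  simp_rw [heckeS2_apply, map_sum, rep_mul_apply]

/-- Starting from a torus eigenvector fixed by the upper unipotent matrices, one finds a common
eigenvector of the two Hecke operators inside every subspace stable under them. -/
lemma exists_hecke_eigenvector {w : V} (hw0 : w ≠ 0) (hw : UFixed ρ w) (ht : TorusEigen ρ w)
    (W : Submodule (kb p) V) (hwW : w ∈ W)
    (h1 : ∀ v ∈ W, UFixed ρ v → heckeS1 ρ v ∈ W) (h2 : ∀ v ∈ W, UFixed ρ v → heckeS2 ρ v ∈ W) :
    ∃ y ∈ W, y ≠ 0 ∧ UFixed ρ y ∧ TorusEigen ρ y ∧ (∃ c : kb p, heckeS1 ρ y = c • y) ∧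
      ∃ c : kb p, heckeS2 ρ y = c • y := by
  set A := heckeS1 ρ
  set B := heckeS2 ρ
  by_cases h121 : A (B (A w)) = 0
  · by_cases h21 : B (A w) = 0
    · by_cases h12 : A (B w) = 0
      · by_cases ha : A w = 0
        · by_cases hb : B w = 0
          · exact ⟨w, hwW, hw0, hw, ht, ⟨0, by rw [ha, zero_smul]⟩, ⟨0, by rw [hb, zero_smul]⟩⟩
          · exact ⟨B w, h2 _ hwW hw, hb, hw.heckeS2, ht.heckeS2, ⟨0, by rw [h12, zero_smul]⟩,
              heckeS2_sq hw ht⟩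
        · exact ⟨A w, h1 _ hwW hw, ha, hw.heckeS1, ht.heckeS1, heckeS1_sq hw ht,
            ⟨0, by rw [h21, zero_smul]⟩⟩
      · exact ⟨A (B w), h1 _ (h2 _ hwW hw) hw.heckeS2, h12, hw.heckeS2.heckeS1,
          ht.heckeS2.heckeS1, heckeS1_sq hw.heckeS2 ht.heckeS2,
          ⟨0, by rw [zero_smul, ← h121]; exact (heckeS_braid w).symm⟩⟩
    · exact ⟨B (A w), h2 _ (h1 _ hwW hw) hw.heckeS1, h21, hw.heckeS1.heckeS2,
        ht.heckeS1.heckeS2, ⟨0, by rw [h121, zero_smul]⟩, heckeS2_sq hw.heckeS1 ht.heckeS1⟩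
  · refine ⟨A (B (A w)), h1 _ (h2 _ (h1 _ hwW hw) hw.heckeS1) hw.heckeS1.heckeS2, h121,
      hw.heckeS1.heckeS2.heckeS1, ht.heckeS1.heckeS2.heckeS1,
      heckeS1_sq hw.heckeS1.heckeS2 ht.heckeS1.heckeS2, ?_⟩
    have h := heckeS_braid (ρ := ρ) w
    change A (B (A w)) = B (A (B w)) at h
    rw [h]
    exact heckeS2_sq hw.heckeS2.heckeS1 ht.heckeS2.heckeS1

lemma mem_of_generators (W : Submodule (kb p) V)
    (ht : ∀ d, ∀ v ∈ W, ρ (torus d) v ∈ W) (hl : ∀ a b c, ∀ v ∈ W, ρ (lowerU a b c) v ∈ W)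
    (h1 : ∀ v ∈ W, ρ (refl1 0) v ∈ W) (h2 : ∀ v ∈ W, ρ (refl2 0) v ∈ W) (g : Gk p 3) :
    ∀ v ∈ W, ρ g v ∈ W := by
  suffices H : ∀ g' : Gk p 3, g'.val = g.val → ∀ v ∈ W, ρ g' v ∈ W from H g rfl
  refine Matrix.diagonal_transvection_induction_of_det_ne_zero
    (fun M => ∀ g' : Gk p 3, g'.val = M → ∀ v ∈ W, ρ g' v ∈ W) g.val
    (GeneralLinearGroup.det g).ne_zero ?_ ?_ ?_
  · intro D hD g' hg' v hv
    rw [Matrix.det_diagonal] at hD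
    have hD' : ∀ i, D i ≠ 0 := fun i hi => hD (Finset.prod_eq_zero (Finset.mem_univ i) hi)
    have : g' = torus fun i => Units.mk0 (D i) (hD' i) := Units.ext (by rw [hg']; simp [torus])
    rw [this]
    exact ht _ v hv
  · rintro ⟨i, j, hij, c⟩ g' hg' v hv
    have e1 : ∀ (h k : Gk p 3), (∀ v ∈ W, ρ h v ∈ W) → (∀ v ∈ W, ρ k v ∈ W) →
        ∀ v ∈ W, ρ (h * k * h) v ∈ W := by
      intro h k hh hk v hv
      rw [rep_mul_apply, rep_mul_apply]
      exact hh _ (hk _ (hh _ hv))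
    have key : g' = lowerU c 0 0 ∨ g' = lowerU 0 c 0 ∨ g' = lowerU 0 0 c ∨
        g' = refl1 0 * lowerU c 0 0 * refl1 0 ∨ g' = refl2 0 * lowerU 0 0 c * refl2 0 ∨
        g' = refl1 0 * (refl2 0 * (refl1 0 * lowerU 0 c 0 * refl1 0) * refl2 0) * refl1 0 := by
      simp only [TransvectionStruct.toMatrix, Matrix.transvection] at hg'
      simp only [Units.ext_iff, hg', ← Matrix.ext_iff]
      fin_cases i <;> fin_cases j <;>
        simp [lowerU, refl1, refl2, Fin.forall_fin_succ, Matrix.mul_apply, Fin.sum_univ_three,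
          Matrix.single_apply] at hij ⊢
    rcases key with rfl | rfl | rfl | rfl | rfl | rfl
    · exact hl _ _ _ v hv
    · exact hl _ _ _ v hv
    · exact hl _ _ _ v hv
    · exact e1 _ _ h1 (hl _ _ _) v hv
    · exact e1 _ _ h2 (hl _ _ _) v hv
    · exact e1 _ _ h1 (e1 _ _ h2 (e1 _ _ h1 (hl _ _ _))) v hv
  · intro A B hA hB ihA ihB g' hg' v hv
    have : g' = GeneralLinearGroup.mkOfDetNeZero A hA * GeneralLinearGroup.mkOfDetNeZero B hB :=
      Units.ext (by rw [hg']; rfl)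
    rw [this, rep_mul_apply]
    exact ihA _ rfl _ (ihB _ rfl v hv)

lemma lowerSpan_eq_top (hirr : IsIrred p 3 ρ) {y : V} (hy0 : y ≠ 0) (hy : UFixed ρ y)
    (ht : TorusEigen ρ y) (h1 : ∃ c : kb p, heckeS1 ρ y = c • y)
    (h2 : ∃ c : kb p, heckeS2 ρ y = c • y) : lowerSpan ρ y = ⊤ := by
  have hlow : ∀ a b c : ZMod p, ρ (lowerU a b c) y ∈ lowerSpan ρ y := fun a b c =>
    Submodule.subset_span ⟨a, b, c, rfl⟩
  have hyW : y ∈ lowerSpan ρ y := by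
    have := hlow 0 0 0
    rwa [lowerU_zero, map_one] at this
  have of_gen : ∀ g : Gk p 3, (∀ a b c, ρ g (ρ (lowerU a b c) y) ∈ lowerSpan ρ y) →
      ∀ v ∈ lowerSpan ρ y, ρ g v ∈ lowerSpan ρ y := by
    intro g hg
    refine Submodule.span_le (p := (lowerSpan ρ y).comap (ρ g)) |>.mpr ?_
    rintro _ ⟨a, b, c, rfl⟩
    exact hg a b c
  have hl : ∀ a b c, ∀ v ∈ lowerSpan ρ y, ρ (lowerU a b c) v ∈ lowerSpan ρ y := by
    intro a b c
    refine of_gen _ fun a' b' c' => ?_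
    rw [← rep_mul_apply, lowerU_mul]
    exact hlow _ _ _
  have ht' : ∀ d, ρ (torus d) y ∈ lowerSpan ρ y := fun d => by
    obtain ⟨c, hc⟩ := ht d
    rw [hc]
    exact Submodule.smul_mem _ _ hyW
  have hr1' : ∀ x : ZMod p, x ≠ 0 → ρ (refl1 x) y ∈ lowerSpan ρ y := by
    intro x hx
    lift x to (ZMod p)ˣ using hx.isUnit
    rw [refl1_unit, rep_mul_apply, rep_mul_apply, hy]
    exact hl _ _ _ _ (ht' _)
  have hr2' : ∀ x : ZMod p, x ≠ 0 → ρ (refl2 x) y ∈ lowerSpan ρ y := by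
    intro x hx
    lift x to (ZMod p)ˣ using hx.isUnit
    rw [refl2_unit, rep_mul_apply, rep_mul_apply, hy]
    exact hl _ _ _ _ (ht' _)
  have hr1 : ∀ x : ZMod p, ρ (refl1 x) y ∈ lowerSpan ρ y := by
    intro x
    rcases eq_or_ne x 0 with rfl | hx
    · obtain ⟨c, hc⟩ := h1
      rw [heckeS1_apply, ← Finset.add_sum_erase _ _ (Finset.mem_univ 0)] at hc
      rw [eq_sub_of_add_eq hc]
      exact Submodule.sub_mem _ (Submodule.smul_mem _ _ hyW)
        (Submodule.sum_mem _ fun x hx => hr1' x (Finset.ne_of_mem_erase hx))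
    · exact hr1' x hx
  have hr2 : ∀ x : ZMod p, ρ (refl2 x) y ∈ lowerSpan ρ y := by
    intro x
    rcases eq_or_ne x 0 with rfl | hx
    · obtain ⟨c, hc⟩ := h2
      rw [heckeS2_apply, ← Finset.add_sum_erase _ _ (Finset.mem_univ 0)] at hc
      rw [eq_sub_of_add_eq hc]
      exact Submodule.sub_mem _ (Submodule.smul_mem _ _ hyW)
        (Submodule.sum_mem _ fun x hx => hr2' x (Finset.ne_of_mem_erase hx))
    · exact hr2' x hx
  refine (hirr.2 _ (mem_of_generators _ ?_ hl ?_ ?_)).resolve_left ?_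
  · intro d
    refine of_gen _ fun a b c => ?_
    rw [← rep_mul_apply, torus_mul_lowerU, rep_mul_apply]
    exact hl _ _ _ _ (ht' d)
  · refine of_gen _ fun a b c => ?_
    rw [← rep_mul_apply, refl1_mul_lowerU, rep_mul_apply]
    exact hl _ _ _ _ (hr1 _)
  · refine of_gen _ fun a b c => ?_
    rw [← rep_mul_apply, refl2_mul_lowerU, rep_mul_apply]
    exact hl _ _ _ _ (hr2 _)
  · intro h
    rw [h, Submodule.mem_bot] at hyW
    exact hy0 hyW

/-- A one-parameter group of operators indexed by `ZMod p` in characteristic `p` has a nonzero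
fixed vector in every nonzero stable subspace. -/
lemma exists_fixed_of_additive {W : Type*} [AddCommGroup W] [Module (kb p) W]
    (A : ZMod p → Module.End (kb p) W) (h0 : A 0 = 1) (hadd : ∀ x y, A (x + y) = A x * A y)
    (S : Submodule (kb p) W) (hS : ∀ x, ∀ v ∈ S, A x v ∈ S) {v : W} (hv : v ∈ S) (hv0 : v ≠ 0) :
    ∃ u ∈ S, u ≠ 0 ∧ ∀ x, A x u = u := by
  have : Nontrivial W := ⟨v, 0, hv0⟩
  have : CharP (Module.End (kb p) W) p :=
    charP_of_injective_algebraMap (algebraMap (kb p) (Module.End (kb p) W)).injective p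
  have hpow : ∀ n : ℕ, A n = A 1 ^ n := by
    intro n
    induction n with
    | zero => simp [h0]
    | succ n ih => rw [Nat.cast_succ, hadd, ih, pow_succ]
  have hnil : (A 1 - 1) ^ p = 0 := by
    rw [sub_pow_char_of_commute _ (Commute.one_right _), ← hpow, CharP.cast_eq_zero, h0,
      one_pow, sub_self]
  have hex : ∃ n, ((A 1 - 1 : Module.End (kb p) W) ^ n) v = 0 := ⟨p, by rw [hnil]; rfl⟩
  classical
  have hpos : Nat.find hex ≠ 0 := by
    intro h
    have := Nat.find_spec hex
    rw [h] at this
    exact hv0 this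
  obtain ⟨m, hm⟩ := Nat.exists_eq_succ_of_ne_zero hpos
  have hmem : ∀ n, ((A 1 - 1 : Module.End (kb p) W) ^ n) v ∈ S := by
    intro n
    induction n with
    | zero => simpa using hv
    | succ n ih =>
      rw [pow_succ']
      exact S.sub_mem (hS 1 _ ih) ih
  have hfix : A 1 (((A 1 - 1 : Module.End (kb p) W) ^ m) v) = ((A 1 - 1 : Module.End (kb p) W) ^ m) v := by
    have := Nat.find_spec hex
    rw [hm, pow_succ'] at this
    exact sub_eq_zero.mp this
  refine ⟨((A 1 - 1 : Module.End (kb p) W) ^ m) v, hmem m, Nat.find_min hex (by omega), fun x => ?_⟩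
  obtain ⟨n, rfl⟩ := ZMod.natCast_zmod_surjective x
  rw [hpow]
  induction n with
  | zero => simp
  | succ n ih => rw [pow_succ, Module.End.mul_apply, hfix, ih]

lemma exists_lower_invariant_functional (ρ : Representation (kb p) (Gk p 3) V) {v : V}
    (hv : v ≠ 0) :
    ∃ l : Module.Dual (kb p) V, l ≠ 0 ∧ ∀ a b c u, l (ρ (lowerU a b c) u) = l u := by
  obtain ⟨l₀, hl₀⟩ : ∃ l : Module.Dual (kb p) V, l v ≠ 0 := by
    by_contra! h
    exact hv ((Module.forall_dual_apply_eq_zero_iff (kb p) v).mp h)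
  let A (g : ZMod p → Gk p 3) (x : ZMod p) : Module.End (kb p) (Module.Dual (kb p) V) :=
    Module.Dual.transpose (ρ (g x))
  have hA : ∀ g x l u, A g x l u = l (ρ (g x) u) := fun _ _ _ _ => rfl
  have hA0 : ∀ g, g 0 = 1 → A g 0 = 1 := by
    intro g hg
    ext l u
    rw [hA, hg, map_one]
    rfl
  have hAadd : ∀ g, (∀ x y, g (x + y) = g x * g y) → ∀ x y, A g (x + y) = A g x * A g y := by
    intro g hg x y
    ext l u
    rw [add_comm, hA, hg, rep_mul_apply]
    rfl
  let g₁ : ZMod p → Gk p 3 := fun x => lowerU 0 x 0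
  let g₂ : ZMod p → Gk p 3 := fun x => lowerU x 0 0
  let g₃ : ZMod p → Gk p 3 := fun x => lowerU 0 0 x
  let S₁ : Submodule (kb p) (Module.Dual (kb p) V) := ⨅ x, LinearMap.eqLocus (A g₁ x) 1
  let S₂ : Submodule (kb p) (Module.Dual (kb p) V) := S₁ ⊓ ⨅ x, LinearMap.eqLocus (A g₂ x) 1
  have mS₁ : ∀ l, l ∈ S₁ ↔ ∀ x u, l (ρ (lowerU 0 x 0) u) = l u := by
    intro l
    simp only [S₁, Submodule.mem_iInf, LinearMap.mem_eqLocus, LinearMap.ext_iff]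
    rfl
  have mS₂ : ∀ l, l ∈ S₂ ↔ l ∈ S₁ ∧ ∀ x u, l (ρ (lowerU x 0 0) u) = l u := by
    intro l
    simp only [S₂, Submodule.mem_inf, Submodule.mem_iInf, LinearMap.mem_eqLocus,
      LinearMap.ext_iff]
    rfl
  obtain ⟨l₁, -, hl₁, hf₁⟩ := exists_fixed_of_additive (A g₁) (hA0 _ lowerU_zero)
    (hAadd _ fun x y => by simp [g₁, lowerU_mul]) ⊤ (fun _ _ _ => trivial)
    (Submodule.mem_top (x := l₀)) (by rintro rfl; exact hl₀ rfl)
  have m₁ : l₁ ∈ S₁ := (mS₁ _).mpr fun x u => LinearMap.congr_fun (hf₁ x) u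
  obtain ⟨l₂, hl₂S, hl₂, hf₂⟩ := exists_fixed_of_additive (A g₂) (hA0 _ lowerU_zero)
    (hAadd _ fun x y => by simp [g₂, lowerU_mul]) S₁ (by
      intro x l hl
      rw [mS₁] at hl ⊢
      intro y u
      rw [hA, hA, ← hl y (ρ (g₂ x) u), ← rep_mul_apply, ← rep_mul_apply]
      simp [g₂, lowerU_mul]) m₁ hl₁
  have m₂ : l₂ ∈ S₂ := (mS₂ _).mpr ⟨hl₂S, fun x u => LinearMap.congr_fun (hf₂ x) u⟩
  obtain ⟨l₃, hl₃S, hl₃, hf₃⟩ := exists_fixed_of_additive (A g₃) (hA0 _ lowerU_zero)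
    (hAadd _ fun x y => by simp [g₃, lowerU_mul]) S₂ (by
      intro x l hl
      rw [mS₂, mS₁] at hl ⊢
      refine ⟨fun y u => ?_, fun y u => ?_⟩
      · rw [hA, hA, ← hl.1 y (ρ (g₃ x) u), ← rep_mul_apply, ← rep_mul_apply]
        simp [g₃, lowerU_mul]
      · rw [hA, hA, ← hl.2 y (ρ (g₃ x) u), ← hl.1 (x * y) (ρ (lowerU y 0 0) (ρ (g₃ x) u)),
          ← rep_mul_apply, ← rep_mul_apply, ← rep_mul_apply]
        simp [g₃, lowerU_mul]) m₂ hl₂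
  rw [mS₂, mS₁] at hl₃S
  refine ⟨l₃, hl₃, fun a b c u => ?_⟩
  have h : lowerU a b c = lowerU 0 b 0 * (lowerU a 0 0 * lowerU 0 0 c) := by
    simp [lowerU_mul]
  rw [h, rep_mul_apply, hl₃S.1, rep_mul_apply, hl₃S.2]
  exact LinearMap.congr_fun (hf₃ c) u

/-- In an irreducible representation the diagonal matrices act through the same character on all
their eigenvectors fixed by the upper unipotent matrices. -/
theorem torus_character_unique (hirr : IsIrred p 3 ρ) {v w : V} (hv0 : v ≠ 0) (hw0 : w ≠ 0)
    (hv : UFixed ρ v) (hw : UFixed ρ w) (ξ ξ' : (Fin 3 → (ZMod p)ˣ) → kb p)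
    (hξ : ∀ d, ρ (torus d) v = ξ d • v) (hξ' : ∀ d, ρ (torus d) w = ξ' d • w) : ξ = ξ' := by
  have vanish : ∀ y : V, lowerSpan ρ y = ⊤ → ∀ l : Module.Dual (kb p) V,
      (∀ a b c u, l (ρ (lowerU a b c) u) = l u) → l y = 0 → l = 0 := by
    intro y hy l hl hly
    rw [← LinearMap.ker_eq_top, eq_top_iff, ← hy]
    refine Submodule.span_le.mpr ?_
    rintro _ ⟨a, b, c, rfl⟩
    exact (hl a b c y).trans hly
  obtain ⟨y, -, hy0, hy, hty, hy1, hy2⟩ := exists_hecke_eigenvector hv0 hv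
    (fun d => ⟨_, hξ d⟩) ⊤ trivial (fun _ _ _ => trivial) (fun _ _ _ => trivial)
  have hspan := lowerSpan_eq_top hirr hy0 hy hty hy1 hy2
  obtain ⟨l, hl0, hl⟩ := exists_lower_invariant_functional ρ hv0
  have hly : l y ≠ 0 := fun h => hl0 (vanish y hspan l hl h)
  have prop : ∀ l' : Module.Dual (kb p) V, (∀ a b c u, l' (ρ (lowerU a b c) u) = l' u) →
      ∃ c : kb p, ∀ u, l' u = c * l u := by
    intro l' hl'
    refine ⟨l' y / l y, fun u => ?_⟩
    have := vanish y hspan (l' - (l' y / l y) • l) (fun a b c u => by simp [hl, hl'])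
      (by simp [hly])
    exact sub_eq_zero.mp (LinearMap.congr_fun this u)
  obtain ⟨μ₁, hμ₁⟩ := prop (l ∘ₗ heckeS1 ρ) (by
    intro a b c u
    simp only [LinearMap.comp_apply, heckeS1_apply, map_sum, ← rep_mul_apply, refl1_mul_lowerU]
    simp only [rep_mul_apply, hl]
    exact Equiv.sum_comp (Equiv.addRight a) fun x => l (ρ (refl1 x) u))
  obtain ⟨μ₂, hμ₂⟩ := prop (l ∘ₗ heckeS2 ρ) (by
    intro a b c u
    simp only [LinearMap.comp_apply, heckeS2_apply, map_sum, ← rep_mul_apply, refl2_mul_lowerU]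
    simp only [rep_mul_apply, hl]
    exact Equiv.sum_comp (Equiv.addRight c) fun x => l (ρ (refl2 x) u))
  have nonvanish : ∀ u : V, u ≠ 0 → UFixed ρ u → TorusEigen ρ u → l u ≠ 0 := by
    intro u hu0 hu htu hlu
    obtain ⟨z, hzl, hz0, hz, htz, hz1, hz2⟩ := exists_hecke_eigenvector hu0 hu htu
      (LinearMap.ker l) hlu
      (fun t ht _ => (hμ₁ t).trans (by rw [LinearMap.mem_ker.mp ht, mul_zero]))
      (fun t ht _ => (hμ₂ t).trans (by rw [LinearMap.mem_ker.mp ht, mul_zero]))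
    exact hl0 (vanish z (lowerSpan_eq_top hirr hz0 hz htz hz1 hz2) l hl hzl)
  funext d
  obtain ⟨θ, hθ⟩ := prop (l ∘ₗ ρ (torus d)) (by
    intro a b c u
    rw [LinearMap.comp_apply, ← rep_mul_apply, torus_mul_lowerU, rep_mul_apply, hl]
    rfl)
  have h1 := hθ v
  have h2 := hθ w
  rw [LinearMap.comp_apply, hξ, map_smul, smul_eq_mul] at h1
  rw [LinearMap.comp_apply, hξ', map_smul, smul_eq_mul] at h2
  rw [mul_right_cancel₀ (nonvanish v hv0 hv fun d => ⟨_, hξ d⟩) h1,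
    mul_right_cancel₀ (nonvanish w hw0 hw fun d => ⟨_, hξ' d⟩) h2]

end FiniteGroup

section PadicGroup

variable {p}

lemma toZMod_eq_zero_iff (x : ℤ_[p]) : PadicInt.toZMod x = 0 ↔ ‖x‖ < 1 := by
  rw [← RingHom.mem_ker, PadicInt.ker_toZMod, IsLocalRing.mem_maximalIdeal, PadicInt.mem_nonunits]

lemma iotaM_apply (m : MM p 3) (i j : Fin 3) : (iotaM p 3 m) i j = ((m i j : ℤ_[p]) : ℚ_[p]) := rfl

lemma redM_apply (m : MM p 3) (i j : Fin 3) : (redM p 3 m) i j = PadicInt.toZMod (m i j) := rfl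

lemma mem_Ipre_iff (m : MM p 3) : m ∈ Ipre p 3 ↔ ∀ i j, j < i → ‖m i j‖ < 1 := by
  simp only [Ipre, Set.mem_ofPred_eq, redM_apply, toZMod_eq_zero_iff]

lemma mem_I1pre_iff (m : MM p 3) :
    m ∈ I1pre p 3 ↔ (∀ i j, j < i → ‖m i j‖ < 1) ∧ ∀ i, ‖m i i - 1‖ < 1 := by
  simp only [I1pre, Set.mem_ofPred_eq, mem_Ipre_iff, redM_apply, ← toZMod_eq_zero_iff (_ - _),
    map_sub, map_one, sub_eq_zero]

lemma exists_iotaM_eq {g : GG p 3} (h : ∀ i j, ‖g i j‖ ≤ 1)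
    (hd : ‖(GeneralLinearGroup.det g : ℚ_[p])‖ = 1) : ∃ m : MM p 3, iotaM p 3 m = g := by
  let A : Matrix (Fin 3) (Fin 3) ℤ_[p] := fun i j => ⟨g i j, h i j⟩
  have hA : A.map (PadicInt.Coe.ringHom) = g.val := by
    ext i j
    rfl
  have hdet : ((A.det : ℤ_[p]) : ℚ_[p]) = (GeneralLinearGroup.det g : ℚ_[p]) := by
    rw [GeneralLinearGroup.val_det_apply, ← hA]
    exact RingHom.map_det PadicInt.Coe.ringHom A
  have hu : IsUnit A.det := by
    rw [PadicInt.isUnit_iff, PadicInt.norm_def, hdet, hd]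
  exact ⟨GeneralLinearGroup.mk'' A hu, Units.ext hA⟩

lemma norm_det_iotaM (m : MM p 3) :
    ‖(GeneralLinearGroup.det (iotaM p 3 m) : ℚ_[p])‖ = 1 := by
  have : (GeneralLinearGroup.det (iotaM p 3 m) : ℚ_[p]) =
      ((GeneralLinearGroup.det m : ℤ_[p]) : ℚ_[p]) := by
    rw [GeneralLinearGroup.val_det_apply, GeneralLinearGroup.val_det_apply]
    exact (RingHom.map_det PadicInt.Coe.ringHom m.val).symm
  rw [this, ← PadicInt.norm_def, PadicInt.norm_units]

lemma mem_Kset_iff (g : GG p 3) :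
    g ∈ Kset p 3 ↔ (∀ i j, ‖g i j‖ ≤ 1) ∧ ‖(GeneralLinearGroup.det g : ℚ_[p])‖ = 1 := by
  constructor
  · rintro ⟨m, rfl⟩
    exact ⟨fun i j => PadicInt.norm_le_one _, norm_det_iotaM m⟩
  · rintro ⟨h, hd⟩
    exact exists_iotaM_eq h hd

lemma mem_I1set_iff (g : GG p 3) :
    g ∈ I1set p 3 ↔ (∀ i j, ‖g i j‖ ≤ 1) ∧ (∀ i j, j < i → ‖g i j‖ < 1) ∧
      ∀ i, ‖g i i - 1‖ < 1 := by
  constructor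
  · rintro ⟨m, hm, rfl⟩
    rw [mem_I1pre_iff] at hm
    exact ⟨fun i j => PadicInt.norm_le_one _, hm.1, hm.2⟩
  · rintro ⟨h, hl, hd⟩
    let A : Matrix (Fin 3) (Fin 3) ℤ_[p] := fun i j => ⟨g i j, h i j⟩
    have hA : A.map (PadicInt.Coe.ringHom) = g.val := by
      ext i j
      rfl
    have hdiag : ∀ i, PadicInt.toZMod (A i i) = 1 := fun i => by
      rw [← sub_eq_zero, ← map_one PadicInt.toZMod, ← map_sub, toZMod_eq_zero_iff]
      exact hd i
    have hlow : ∀ i j, j < i → PadicInt.toZMod (A i j) = 0 := fun i j hij =>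
      (toZMod_eq_zero_iff _).mpr (hl i j hij)
    have hu : IsUnit A.det := by
      by_contra hcon
      rw [PadicInt.not_isUnit_iff, ← toZMod_eq_zero_iff, Matrix.det_fin_three] at hcon
      simp only [map_sub, map_add, map_mul, hdiag, hlow 1 0 (by decide), hlow 2 0 (by decide),
        hlow 2 1 (by decide)] at hcon
      simp at hcon
    exact ⟨GeneralLinearGroup.mk'' A hu, (mem_I1pre_iff _).mpr ⟨hl, hd⟩, Units.ext hA⟩

lemma redM_of_mem_I1pre {m : MM p 3} (hm : m ∈ I1pre p 3) :
    redM p 3 m = upperU (redM p 3 m 0 1) (redM p 3 m 0 2) (redM p 3 m 1 2) := by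
  refine Units.ext (Matrix.ext fun i j => ?_)
  fin_cases i <;> fin_cases j <;>
    simp [upperU, hm.2, hm.1 1 0 (by decide), hm.1 2 0 (by decide), hm.1 2 1 (by decide)]

lemma mem_I1pre_of_redM {m : MM p 3} {a b c : ZMod p} (h : redM p 3 m = upperU a b c) :
    m ∈ I1pre p 3 := by
  refine ⟨fun i j hij => ?_, fun i => ?_⟩
  · rw [h]
    fin_cases i <;> fin_cases j <;> simp [upperU] at hij ⊢
  · rw [h]
    fin_cases i <;> simp [upperU]

lemma upperU_mul {R : Type*} [CommRing R] (a b c a' b' c' : R) :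
    upperU a b c * upperU a' b' c' = upperU (a' + a) (b' + a * c' + b) (c' + c) := by
  refine Units.ext (Matrix.ext fun i j => ?_)
  fin_cases i <;> fin_cases j <;> simp [upperU, Matrix.mul_apply, Fin.sum_univ_three]

lemma upperU_inv {R : Type*} [CommRing R] (a b c : R) :
    (upperU a b c)⁻¹ = upperU (-a) (a * c - b) (-c) := Units.ext rfl

variable (p) in
/-- The pro-p Iwahori subgroup. -/
def I1 : Subgroup (GG p 3) where
  carrier := I1set p 3
  one_mem' := by
    rw [mem_I1set_iff]
    refine ⟨fun i j => ?_, fun i j hij => ?_, fun i => ?_⟩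
    · fin_cases i <;> fin_cases j <;> simp
    · simp [Matrix.one_apply_ne hij.ne']
    · simp
  mul_mem' := by
    rintro _ _ ⟨m, hm, rfl⟩ ⟨m', hm', rfl⟩
    have h := map_mul (redM p 3) m m'
    rw [redM_of_mem_I1pre hm, redM_of_mem_I1pre hm', upperU_mul] at h
    exact ⟨m * m', mem_I1pre_of_redM h, map_mul _ _ _⟩
  inv_mem' := by
    rintro _ ⟨m, hm, rfl⟩
    have h := map_inv (redM p 3) m
    rw [redM_of_mem_I1pre hm, upperU_inv] at h
    exact ⟨m⁻¹, mem_I1pre_of_redM h, map_inv _ _⟩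

lemma mem_I1_iff (g : GG p 3) :
    g ∈ I1 p ↔ (∀ i j, ‖g i j‖ ≤ 1) ∧ (∀ i j, j < i → ‖g i j‖ < 1) ∧ ∀ i, ‖g i i - 1‖ < 1 :=
  mem_I1set_iff g

lemma I1_le_Kset {g : GG p 3} (hg : g ∈ I1 p) : g ∈ Kset p 3 := by
  obtain ⟨m, -, rfl⟩ := hg
  exact ⟨m, rfl⟩

/-- The diagonal matrix with entries powers of `p`. -/
def dg (e : Fin 3 → ℤ) : GG p 3 := diagGL p 3 fun i => pU p ^ e i

lemma tGL_eq (a : Fin 2 → ℤ) : tGL p 3 a = dg (expo 3 a) := rfl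

lemma expo_eq (a : Fin 2 → ℤ) : expo 3 a = ![a 0, a 1, 0] := by
  funext i
  fin_cases i <;> rfl

lemma piSc_eq (n : ℤ) : piSc p 3 n = dg fun _ => n := Units.ext rfl

lemma dg_add (e e' : Fin 3 → ℤ) : (dg (e + e') : GG p 3) = dg e * dg e' := by
  refine Units.ext ?_
  simp only [dg, diagGL, Units.val_mul, Matrix.diagonal_mul_diagonal, Pi.add_apply, _root_.zpow_add,
    Units.val_mul]

lemma dg_zero : (dg 0 : GG p 3) = 1 := by
  refine Units.ext ?_
  simp [dg, diagGL]

lemma dg_neg (e : Fin 3 → ℤ) : (dg (-e) : GG p 3) = (dg e)⁻¹ := by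
  rw [eq_inv_iff_mul_eq_one, ← dg_add, neg_add_cancel, dg_zero]

lemma dg_mul_apply (e : Fin 3 → ℤ) (g : GG p 3) (i j : Fin 3) :
    (dg e * g : GG p 3) i j = (p : ℚ_[p]) ^ e i * g i j := by
  rw [Units.val_mul]
  simp only [dg, diagGL, Matrix.diagonal_mul]
  simp [pU]

lemma mul_dg_apply (e : Fin 3 → ℤ) (g : GG p 3) (i j : Fin 3) :
    (g * dg e : GG p 3) i j = g i j * (p : ℚ_[p]) ^ e j := by
  rw [Units.val_mul]
  simp only [dg, diagGL, Matrix.mul_diagonal]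
  simp [pU]

lemma prime_ne_zero : (p : ℚ_[p]) ≠ 0 := Nat.cast_ne_zero.mpr (Fact.out : p.Prime).ne_zero

lemma dg_conj_apply (e : Fin 3 → ℤ) (g : GG p 3) (i j : Fin 3) :
    (dg e * g * (dg e)⁻¹ : GG p 3) i j = (p : ℚ_[p]) ^ (e i - e j) * g i j := by
  rw [← dg_neg, mul_dg_apply, dg_mul_apply, Pi.neg_apply, zpow_sub₀ prime_ne_zero, _root_.zpow_neg]
  ring

lemma piSc_mul_comm (n : ℤ) (g : GG p 3) : piSc p 3 n * g = g * piSc p 3 n := by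
  refine Units.ext (Matrix.ext fun i j => ?_)
  rw [piSc_eq]
  exact (dg_mul_apply (fun _ => n) g i j).trans
    ((mul_comm _ _).trans (mul_dg_apply (fun _ => n) g i j).symm)

lemma norm_det_dg (e : Fin 3 → ℤ) :
    ‖(GeneralLinearGroup.det (dg e : GG p 3) : ℚ_[p])‖ = (p : ℝ) ^ (-(e 0 + e 1 + e 2)) := by
  rw [GeneralLinearGroup.val_det_apply]
  simp only [dg, diagGL, Matrix.det_diagonal, Fin.prod_univ_three]
  simp [pU, zpow_add₀ (Nat.cast_ne_zero.mpr (Fact.out : p.Prime).ne_zero : (p : ℝ) ≠ 0), mul_comm]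

lemma norm_p_zpow_mul_le {x : ℚ_[p]} {n : ℤ} (hn : 0 ≤ n) (hx : ‖x‖ ≤ 1) :
    ‖(p : ℚ_[p]) ^ n * x‖ ≤ 1 := by
  rw [norm_mul, Padic.norm_p_zpow]
  refine mul_le_one₀ ?_ (norm_nonneg _) hx
  exact zpow_le_one_of_nonpos₀ (by exact_mod_cast (Fact.out : p.Prime).one_lt.le) (by omega)

lemma norm_p_zpow_mul_lt {x : ℚ_[p]} {n : ℤ} (hn : 0 < n) (hx : ‖x‖ ≤ 1) :
    ‖(p : ℚ_[p]) ^ n * x‖ < 1 := by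
  rw [norm_mul, Padic.norm_p_zpow]
  refine mul_lt_one_of_nonneg_of_lt_one_left (by positivity) ?_ hx
  exact zpow_lt_one_of_neg₀ (by exact_mod_cast (Fact.out : p.Prime).one_lt) (by omega)

lemma norm_p_zpow_mul_lt' {x : ℚ_[p]} {n : ℤ} (hn : 0 ≤ n) (hx : ‖x‖ < 1) :
    ‖(p : ℚ_[p]) ^ n * x‖ < 1 := by
  rw [norm_mul, Padic.norm_p_zpow]
  refine mul_lt_one_of_nonneg_of_lt_one_right ?_ (norm_nonneg _) hx
  exact zpow_le_one_of_nonpos₀ (by exact_mod_cast (Fact.out : p.Prime).one_lt.le) (by omega)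

end PadicGroup

section Elementary

variable {p}

/-- The elementary matrix `1 + x E_{ij}` as an invertible matrix. -/
def elemGL {R : Type*} [CommRing R] {i j : Fin 3} (h : i ≠ j) (x : R) : GL (Fin 3) R where
  val := Matrix.transvection i j x
  inv := Matrix.transvection i j (-x)
  val_inv := by simp [Matrix.transvection_mul_transvection_same _ _ h]
  inv_val := by simp [Matrix.transvection_mul_transvection_same _ _ h]

lemma elemGL_apply {R : Type*} [CommRing R] {i j : Fin 3} (h : i ≠ j) (x : R) (k l : Fin 3) :
    elemGL h x k l = (if k = l then 1 else 0) + if i = k ∧ j = l then x else 0 := by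
  simp [elemGL, Matrix.transvection, Matrix.one_apply, Matrix.single_apply]

lemma elemGL_pow {R : Type*} [CommRing R] {i j : Fin 3} (h : i ≠ j) (x : R) (n : ℕ) :
    elemGL h x ^ n = elemGL h (n * x) := by
  induction n with
  | zero => exact Units.ext (by simp [elemGL])
  | succ n ih =>
    rw [pow_succ, ih]
    refine Units.ext ?_
    simp only [elemGL, Units.val_mul, Matrix.transvection_mul_transvection_same _ _ h]
    push_cast
    ring_nf

lemma elemGL_map {R S : Type*} [CommRing R] [CommRing S] (φ : R →+* S) {i j : Fin 3} (h : i ≠ j)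
    (x : R) : GeneralLinearGroup.map φ (elemGL h x) = elemGL h (φ x) := by
  refine Units.ext (Matrix.ext fun k l => ?_)
  rw [GeneralLinearGroup.map_apply, elemGL_apply, elemGL_apply]
  split_ifs <;> simp

lemma dg_conj_elemGL (e : Fin 3 → ℤ) {i j : Fin 3} (h : i ≠ j) (x : ℚ_[p]) :
    dg e * elemGL h x * (dg e)⁻¹ = elemGL h ((p : ℚ_[p]) ^ (e i - e j) * x) := by
  refine Units.ext (Matrix.ext fun k l => ?_)
  rw [dg_conj_apply, elemGL_apply, elemGL_apply]
  by_cases hkl : k = l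
  · subst hkl
    have : ¬ (i = k ∧ j = k) := fun hh => h (hh.1.trans hh.2.symm)
    simp [this]
  · by_cases hij : i = k ∧ j = l
    · obtain ⟨rfl, rfl⟩ := hij
      simp [hkl]
    · simp [hkl, hij]

lemma elemGL_mem_I1 {i j : Fin 3} (h : i ≠ j) {x : ℚ_[p]} (hx : ‖x‖ ≤ 1)
    (hlt : j < i → ‖x‖ < 1) : elemGL h x ∈ I1 p := by
  rw [mem_I1_iff]
  refine ⟨fun k l => ?_, fun k l hkl => ?_, fun k => ?_⟩
  · rw [elemGL_apply]
    by_cases hkl : k = l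
    · subst hkl
      have : ¬ (i = k ∧ j = k) := fun hh => h (hh.1.trans hh.2.symm)
      simp [this]
    · rw [if_neg hkl, zero_add]
      split_ifs
      · exact hx
      · simp
  · rw [elemGL_apply, if_neg hkl.ne', zero_add]
    split_ifs with hh
    · exact hlt (by rw [hh.1, hh.2]; exact hkl)
    · simp
  · have : ¬ (i = k ∧ j = k) := fun hh => h (hh.1.trans hh.2.symm)
    simp [elemGL_apply, this]

lemma norm_elemGL_apply {i j : Fin 3} (h : i ≠ j) (x : ℚ_[p]) : (elemGL h x) i j = x := by
  simp [elemGL_apply, h]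

lemma elemGL_coe (x : ℤ_[p]) {i j : Fin 3} (h : i ≠ j) :
    elemGL h (x : ℚ_[p]) = iotaM p 3 (elemGL h x) :=
  (elemGL_map PadicInt.Coe.ringHom h x).symm

/-- The set of standard indices consists of monotone exponents. -/
lemma monotone_of_mem_Sset {a : Fin 2 → ℤ} (ha : a ∈ Sset p 3 1) : Monotone (expo 3 a) := by
  have hw : wS p 3 1 a = dg (expo 3 a) := by
    have : permGL p 3 1 = 1 := Units.ext (by simp [permGL])
    rw [wS, this, one_mul, tGL_eq]
  intro j i hji
  by_contra hlt
  rw [not_le] at hlt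
  have hij : i ≠ j := by
    rintro rfl
    exact lt_irrefl _ hlt
  have hji' : j < i := lt_of_le_of_ne hji hij.symm
  set e := expo 3 a
  have hx : ‖(p : ℚ_[p]) ^ (e j - e i) * 1‖ < 1 := norm_p_zpow_mul_lt (by omega) (by simp)
  rw [mul_one] at hx
  have hI1 : elemGL hij ((p : ℚ_[p]) ^ (e j - e i)) ∈ I1 p :=
    elemGL_mem_I1 hij hx.le fun _ => hx
  have hI : elemGL hij ((p : ℚ_[p]) ^ (e j - e i)) ∈ Iset p 3 := by
    obtain ⟨m, hm, hm'⟩ := hI1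
    exact ⟨m, hm.1, hm'⟩
  have hc : wS p 3 1 a * elemGL hij ((p : ℚ_[p]) ^ (e j - e i)) * (wS p 3 1 a)⁻¹ =
      iotaM p 3 (elemGL hij 1) := by
    rw [hw, dg_conj_elemGL, ← elemGL_coe, ← zpow_add₀ prime_ne_zero, sub_add_sub_cancel,
      sub_self, zpow_zero, PadicInt.coe_one]
  have := ha _ hI (by rw [hc]; exact ⟨_, rfl⟩)
  rw [hc] at this
  obtain ⟨m, hm, hm'⟩ := this
  have hone : (m i j : ℚ_[p]) = 1 := by
    have : (iotaM p 3 m) i j = 1 := by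
      rw [hm', ← elemGL_coe, norm_elemGL_apply, PadicInt.coe_one]
    exact this
  have h1 : m i j = 1 := PadicInt.ext hone
  have := (mem_Ipre_iff m).mp hm i j hji'
  rw [h1, norm_one] at this
  exact lt_irrefl _ this

/-- The permutation matrix conjugating `M` to `M.submatrix σ σ`. -/
def permSub {R : Type*} [CommRing R] (σ : Equiv.Perm (Fin 3)) : GL (Fin 3) R where
  val := (1 : Matrix (Fin 3) (Fin 3) R).submatrix σ id
  inv := (1 : Matrix (Fin 3) (Fin 3) R).submatrix id σ
  val_inv := by
    rw [Matrix.submatrix_mul _ _ _ _ _ Function.bijective_id |>.symm]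
    simp
  inv_val := by
    rw [Matrix.submatrix_mul _ _ _ _ _ σ.bijective |>.symm]
    simp

lemma permSub_conj {R : Type*} [CommRing R] (σ : Equiv.Perm (Fin 3)) (g g' : GL (Fin 3) R)
    (h : ∀ i j, g' i j = g (σ i) (σ j)) : g' * permSub σ = permSub σ * g := by
  refine Units.ext (Matrix.ext fun i j => ?_)
  simp only [Units.val_mul, permSub, Matrix.mul_apply, Matrix.submatrix_apply, Matrix.one_apply, id]
  rw [Finset.sum_eq_single (σ.symm j), Finset.sum_eq_single (σ i)]
  · simp [h]
  · intro b _ hb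
    simp [hb.symm]
  · simp
  · intro b _ hb
    rw [if_neg, mul_zero]
    rintro rfl
    simp at hb
  · simp

end Elementary

section HeckeSum

variable {p}

variable (p) in
/-- The double coset `KZ t_c I_1`. -/
def dblCoset (c : Fin 2 → ℤ) : Set (GG p 3) :=
  {x | ∃ (n : ℤ) (m : MM p 3) (u : GG p 3), u ∈ I1 p ∧ x = piSc p 3 n * iotaM p 3 m * tGL p 3 c * u}

/-- The subgroup `I_1 ∩ g⁻¹ I_1 g`. -/
def stabI1 (g : GG p 3) : Subgroup (GG p 3) := I1 p ⊓ (I1 p).comap (MulAut.conj g).toMonoidHom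

lemma mem_stabI1 {g x : GG p 3} : x ∈ stabI1 g ↔ x ∈ I1 p ∧ g * x * g⁻¹ ∈ I1 p := Iff.rfl

lemma IsRepSet.mem_I1 {g : GG p 3} {R : Finset (GG p 3)} (hR : IsRepSet p 3 g R) {r : GG p 3}
    (hr : r ∈ R) : r ∈ I1 p := hR.1 hr

lemma IsRepSet.exists_rep {g : GG p 3} {R : Finset (GG p 3)} (hR : IsRepSet p 3 g R) {x : GG p 3}
    (hx : x ∈ I1 p) : ∃ r ∈ R, r⁻¹ * x ∈ stabI1 g := by
  obtain ⟨r, ⟨hr, h⟩, -⟩ := hR.2 x hx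
  exact ⟨r, hr, h⟩

lemma IsRepSet.eq_of_mem {g : GG p 3} {R : Finset (GG p 3)} (hR : IsRepSet p 3 g R) {r r' : GG p 3}
    (hr : r ∈ R) (hr' : r' ∈ R) (h : r'⁻¹ * r ∈ stabI1 g) : r = r' := by
  obtain ⟨s, -, hs⟩ := hR.2 r (hR.mem_I1 hr)
  have h1 := hs r ⟨hr, by rw [inv_mul_cancel]; exact (stabI1 g).one_mem⟩
  have h2 := hs r' ⟨hr', h⟩
  rw [h1, h2]

/-- A self-map of `I_1` inducing an injection on cosets permutes the representatives. -/
lemma IsRepSet.exists_perm {g : GG p 3} {R : Finset (GG p 3)} (hR : IsRepSet p 3 g R)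
    (φ : GG p 3 → GG p 3) (hφ : ∀ x ∈ I1 p, φ x ∈ I1 p)
    (hinj : ∀ r ∈ I1 p, ∀ r' ∈ I1 p, (φ r')⁻¹ * φ r ∈ stabI1 g → r'⁻¹ * r ∈ stabI1 g) :
    ∃ π : Equiv.Perm R, ∀ r : R, (π r : GG p 3)⁻¹ * φ r ∈ stabI1 g := by
  have hex : ∀ r : R, ∃ s : R, (s : GG p 3)⁻¹ * φ r ∈ stabI1 g := fun r => by
    obtain ⟨s, hs, h⟩ := hR.exists_rep (hφ r (hR.mem_I1 r.2))
    exact ⟨⟨s, hs⟩, h⟩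
  choose ψ hψ using hex
  have hψi : Function.Injective ψ := by
    intro r r' h
    refine Subtype.ext (hR.eq_of_mem r.2 r'.2 (hinj _ (hR.mem_I1 r.2) _ (hR.mem_I1 r'.2) ?_))
    have h2 := (stabI1 g).mul_mem ((stabI1 g).inv_mem (hψ r')) (hψ r)
    rw [h] at h2
    convert h2 using 1
    group
  exact ⟨Equiv.ofBijective ψ (Finite.injective_iff_bijective.mp hψi), hψ⟩

lemma IsRepSet.sum_comp {g : GG p 3} {R : Finset (GG p 3)} (hR : IsRepSet p 3 g R)
    (φ : GG p 3 → GG p 3) (hφ : ∀ x ∈ I1 p, φ x ∈ I1 p)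
    (hinj : ∀ r ∈ I1 p, ∀ r' ∈ I1 p, (φ r')⁻¹ * φ r ∈ stabI1 g → r'⁻¹ * r ∈ stabI1 g)
    {W : Type*} [AddCommMonoid W] (h : GG p 3 → W)
    (hh : ∀ x, ∀ j ∈ stabI1 g, h (x * j) = h x) :
    ∑ r ∈ R, h (φ r) = ∑ r ∈ R, h r := by
  obtain ⟨π, hπ⟩ := hR.exists_perm φ hφ hinj
  rw [← Finset.sum_coe_sort R, ← Finset.sum_coe_sort R, ← Equiv.sum_comp π fun r : R => h r]
  refine Finset.sum_congr rfl fun r _ => ?_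
  have := hh (π r) _ (hπ r)
  rwa [mul_inv_cancel_left] at this

variable {V : Type} [AddCommGroup V] [Module (kb p) V]
  {ρ : Representation (kb p) (Gk p 3) V}

/-- Left equivariance under `KZ` and right invariance under the pro-`p` Iwahori subgroup. -/
def IsEquivInv (ρ : Representation (kb p) (Gk p 3) V) (F : GG p 3 → V) : Prop :=
  (∀ (n : ℤ) (m : MM p 3) (g : GG p 3),
    F (piSc p 3 n * iotaM p 3 m * g) = ρ (redM p 3 m) (F g)) ∧
  ∀ u ∈ I1 p, ∀ g, F (g * u) = F g

/-- The right torus action on `F` is through `ξ`. -/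
def IsTorusSemi (ξ : (Fin 3 → (ZMod p)ˣ) →* (kb p)ˣ) (F : GG p 3 → V) : Prop :=
  ∀ (d : Fin 3 → ℤ_[p]ˣ) (g : GG p 3), F (g * iotaM p 3 (torus d)) =
    (ξ (fun i => Units.map (PadicInt.toZMod (p := p)).toMonoidHom (d i)) : kb p) • F g

lemma IsEquivInv.apply {F : GG p 3 → V} (hF : IsEquivInv ρ F) (n : ℤ) (m : MM p 3) (t : GG p 3)
    {u : GG p 3} (hu : u ∈ I1 p) : F (piSc p 3 n * iotaM p 3 m * t * u) = ρ (redM p 3 m) (F t) := by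
  rw [hF.2 u hu, hF.1]

lemma IsEquivInv.iotaM_mul {F : GG p 3 → V} (hF : IsEquivInv ρ F) (m : MM p 3) (g : GG p 3) :
    F (iotaM p 3 m * g) = ρ (redM p 3 m) (F g) := by
  have h0 : piSc p 3 0 = 1 := (piSc_eq 0).trans dg_zero
  rw [← hF.1 0 m g, h0, one_mul]

/-- Functions supported on the same double coset are determined by one value. -/
lemma IsEquivInv.ext_of_supp {F F' : GG p 3 → V} (hF : IsEquivInv ρ F) (hF' : IsEquivInv ρ F')
    {c : Fin 2 → ℤ} (hs : ∀ x, F x ≠ 0 → x ∈ dblCoset p c)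
    (hs' : ∀ x, F' x ≠ 0 → x ∈ dblCoset p c) (h : F (tGL p 3 c) = F' (tGL p 3 c)) : F = F' := by
  funext x
  by_cases hx : x ∈ dblCoset p c
  · obtain ⟨n, m, u, hu, rfl⟩ := hx
    rw [hF.apply _ _ _ hu, hF'.apply _ _ _ hu, h]
  · rw [not_not.mp fun h => hx (hs x h), not_not.mp fun h => hx (hs' x h)]

lemma IsEquivInv.stab_inv {f : GG p 3 → V} (hf : IsEquivInv ρ f) (g x : GG p 3) :
    ∀ y, ∀ j ∈ stabI1 g, f (x * (y * j) * g⁻¹) = f (x * y * g⁻¹) := by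
  intro y j hj
  have : x * (y * j) * g⁻¹ = x * y * g⁻¹ * (g * j * g⁻¹) := by group
  rw [this, hf.2 _ (mem_stabI1.mp hj).2]

lemma IsEquivInv.heckeSum {f : GG p 3 → V} (hf : IsEquivInv ρ f) {g : GG p 3} {R : Finset (GG p 3)}
    (hR : IsRepSet p 3 g R) : IsEquivInv ρ (hk p 3 g R f) := by
  refine ⟨fun n m x => ?_, fun u hu x => ?_⟩
  · simp only [hk, map_sum]
    refine Finset.sum_congr rfl fun r _ => ?_
    rw [← hf.1 n m]
    simp only [mul_assoc]
  · simp only [hk]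
    rw [← hR.sum_comp (fun r => u * r) (fun r hr => (I1 p).mul_mem hu hr) (fun r _ r' _ h => by
      convert h using 1
      group) (fun r => f (x * r * g⁻¹)) (hf.stab_inv g x)]
    simp only [mul_assoc]

lemma torus_conj_mem_I1 (d : Fin 3 → ℤ_[p]ˣ) {u : GG p 3} (hu : u ∈ I1 p) :
    iotaM p 3 (torus d) * u * (iotaM p 3 (torus d))⁻¹ ∈ I1 p := by
  obtain ⟨m, hm, rfl⟩ := hu
  refine ⟨torus d * m * (torus d)⁻¹, ?_, by simp⟩
  rw [mem_I1pre_iff] at hm ⊢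
  have key : ∀ i j, (torus d * m * (torus d)⁻¹ : MM p 3) i j = d i * m i j * ((d j)⁻¹ : ℤ_[p]ˣ) := by
    intro i j
    have : ((torus d)⁻¹ : MM p 3).val = Matrix.diagonal fun i => (((d i)⁻¹ : ℤ_[p]ˣ) : ℤ_[p]) := rfl
    rw [Units.val_mul, this, Matrix.mul_diagonal, Units.val_mul]
    simp [torus, Matrix.diagonal_mul]
  refine ⟨fun i j hij => ?_, fun i => ?_⟩
  · rw [key, norm_mul, norm_mul, PadicInt.norm_units, PadicInt.norm_units, one_mul, mul_one]
    exact hm.1 i j hij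
  · rw [key, mul_right_comm, Units.mul_inv, one_mul]
    exact hm.2 i

lemma torus_inv {R : Type*} [CommRing R] (d : Fin 3 → Rˣ) : (torus d)⁻¹ = torus d⁻¹ :=
  Units.ext rfl

lemma dg_mul_torus (e : Fin 3 → ℤ) (d : Fin 3 → ℤ_[p]ˣ) :
    dg e * iotaM p 3 (torus d) = iotaM p 3 (torus d) * dg e := by
  refine Units.ext (Matrix.ext fun i j => ?_)
  rw [dg_mul_apply, mul_dg_apply, iotaM_apply]
  rcases eq_or_ne i j with rfl | hij
  · exact mul_comm _ _
  · simp [torus, Matrix.diagonal_apply_ne _ hij]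

lemma redM_torus (d : Fin 3 → ℤ_[p]ˣ) :
    redM p 3 (torus d) =
      torus fun i => Units.map (PadicInt.toZMod (p := p)).toMonoidHom (d i) := by
  refine Units.ext (Matrix.ext fun i j => ?_)
  rw [redM_apply]
  rcases eq_or_ne i j with rfl | hij
  · simp [torus]
  · simp [torus, Matrix.diagonal_apply_ne _ hij]

lemma dblCoset_mul_torus {c : Fin 2 → ℤ} {x : GG p 3} (hx : x ∈ dblCoset p c)
    (d : Fin 3 → ℤ_[p]ˣ) : x * iotaM p 3 (torus d) ∈ dblCoset p c := by
  obtain ⟨n, m, u, hu, rfl⟩ := hx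
  have hu' := torus_conj_mem_I1 d⁻¹ hu
  rw [← torus_inv, map_inv, inv_inv] at hu'
  refine ⟨n, m * torus d, _, hu', ?_⟩
  rw [map_mul, ← mul_assoc (piSc p 3 n), mul_assoc _ (iotaM p 3 (torus d)) (tGL p 3 c), tGL_eq,
    ← dg_mul_torus]
  group

lemma IsEquivInv.isTorusSemi {f : GG p 3 → V} (hf : IsEquivInv ρ f) {c : Fin 2 → ℤ}
    (hs : ∀ x, f x ≠ 0 → x ∈ dblCoset p c) (ξ : (Fin 3 → (ZMod p)ˣ) →* (kb p)ˣ)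
    (hξ : ∀ d, ρ (torus d) (f (tGL p 3 c)) = (ξ d : kb p) • f (tGL p 3 c)) : IsTorusSemi ξ f := by
  intro d x
  by_cases hx : x ∈ dblCoset p c
  · obtain ⟨n, m, u, hu, rfl⟩ := hx
    have hu' := torus_conj_mem_I1 d⁻¹ hu
    rw [← torus_inv, map_inv, inv_inv] at hu'
    have : piSc p 3 n * iotaM p 3 m * tGL p 3 c * u * iotaM p 3 (torus d) =
        piSc p 3 n * iotaM p 3 (m * torus d) * tGL p 3 c *
          ((iotaM p 3 (torus d))⁻¹ * u * iotaM p 3 (torus d)) := by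
      rw [map_mul, ← mul_assoc (piSc p 3 n), mul_assoc _ (iotaM p 3 (torus d)) (tGL p 3 c), tGL_eq,
        ← dg_mul_torus]
      group
    rw [this, hf.apply _ _ _ hu', hf.apply _ _ _ hu, map_mul, rep_mul_apply, redM_torus, hξ,
      map_smul]
  · have hx' : x * iotaM p 3 (torus d) ∉ dblCoset p c := by
      intro h
      have := dblCoset_mul_torus h d⁻¹
      rw [← torus_inv, map_inv, mul_inv_cancel_right] at this
      exact hx this
    rw [not_not.mp fun h => hx (hs _ h), not_not.mp fun h => hx' (hs _ h), smul_zero]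

lemma IsTorusSemi.heckeSum {ξ : (Fin 3 → (ZMod p)ˣ) →* (kb p)ˣ} {f : GG p 3 → V}
    (hξ : IsTorusSemi ξ f) (hf : IsEquivInv ρ f) {b : Fin 3 → ℤ} {R : Finset (GG p 3)}
    (hR : IsRepSet p 3 (dg b) R) : IsTorusSemi ξ (hk p 3 (dg b) R f) := by
  intro d x
  set δ := iotaM p 3 (torus d) with hδ
  have hcomm : (dg b)⁻¹ * δ = δ * (dg b)⁻¹ := by
    rw [← dg_neg, hδ, dg_mul_torus]
  have hcomm' : ∀ z : GG p 3, dg b * (δ⁻¹ * z * δ) * (dg b)⁻¹ =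
      δ⁻¹ * (dg b * z * (dg b)⁻¹) * δ := by
    intro z
    have h1 : dg b * δ⁻¹ = δ⁻¹ * dg b := by
      rw [eq_inv_mul_iff_mul_eq, ← mul_assoc, hδ, ← dg_mul_torus, mul_inv_cancel_right]
    calc _ = (dg b * δ⁻¹) * z * (δ * (dg b)⁻¹) := by group
      _ = _ := by rw [h1, ← hcomm]; group
  have conj_mem : ∀ z, δ * z * δ⁻¹ ∈ stabI1 (dg b) → z ∈ stabI1 (dg b) := by
    intro z hz
    have ht := fun u hu => torus_conj_mem_I1 d⁻¹ (u := u) hu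
    rw [← torus_inv, map_inv, inv_inv, ← hδ] at ht
    have hz1 : z = δ⁻¹ * (δ * z * δ⁻¹) * δ := by group
    rw [mem_stabI1, hz1, hcomm']
    exact ⟨ht _ hz.1, ht _ hz.2⟩
  have hsum := hR.sum_comp (fun r => δ * r * δ⁻¹) (fun r hr => torus_conj_mem_I1 d hr)
    (fun r _ r' _ h => conj_mem _ (by
      have e : δ * (r'⁻¹ * r) * δ⁻¹ = (δ * r' * δ⁻¹)⁻¹ * (δ * r * δ⁻¹) := by group
      rw [e]
      exact h))
    (fun r => f (x * r * (dg b)⁻¹)) (hf.stab_inv (dg b) x)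
  simp only [hk]
  rw [← hsum, Finset.smul_sum]
  refine Finset.sum_congr rfl fun r _ => ?_
  rw [← hξ d, ← hδ, mul_assoc _ (dg b)⁻¹, hcomm]
  congr 1
  group

end HeckeSum

section Vanishing

variable {p}

variable {V : Type} [AddCommGroup V] [Module (kb p) V]
  {ρ : Representation (kb p) (Gk p 3) V}

lemma exists_unit_lift (x : (ZMod p)ˣ) :
    ∃ y : ℤ_[p]ˣ, Units.map (PadicInt.toZMod (p := p)).toMonoidHom y = x := by
  obtain ⟨y, hy⟩ := ZMod.ringHom_surjective (PadicInt.toZMod (p := p)) x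
  have hu : IsUnit y := by
    by_contra h
    rw [PadicInt.not_isUnit_iff, ← toZMod_eq_zero_iff, hy] at h
    exact x.ne_zero h
  exact ⟨hu.unit, Units.ext hy⟩

lemma uFixed_of_elemGL {w : V}
    (h : ∀ (i j : Fin 3) (hij : i < j) (x : ZMod p), ρ (elemGL hij.ne x) w = w) : UFixed ρ w := by
  intro a b c
  have : upperU a b c = elemGL (show (1 : Fin 3) ≠ 2 by decide) c *
      (elemGL (show (0 : Fin 3) ≠ 1 by decide) a * elemGL (show (0 : Fin 3) ≠ 2 by decide) b) := by
    refine Units.ext (Matrix.ext fun i j => ?_)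
    simp only [Units.val_mul, Matrix.mul_apply, Fin.sum_univ_three, elemGL_apply]
    fin_cases i <;> fin_cases j <;> simp [upperU]
  rw [this, rep_mul_apply, rep_mul_apply, h 0 2 (by decide), h 0 1 (by decide), h 1 2 (by decide)]

/-- For a regular character, an equivariant function vanishes on diagonal matrices whose
exponents are not increasing. -/
lemma IsEquivInv.eq_zero_of_not_monotone (hirr : IsIrred p 3 ρ) {v₀ : V} (hv₀ : v₀ ≠ 0)
    (hU : UFixed ρ v₀) {ξ : (Fin 3 → (ZMod p)ˣ) →* (kb p)ˣ}
    (hT : ∀ d, ρ (torus d) v₀ = (ξ d : kb p) • v₀)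
    (hreg : ∀ ν : Equiv.Perm (Fin 3), ν ≠ 1 → ¬ (∀ d, ξ (d ∘ ⇑ν⁻¹) = ξ d))
    {F : GG p 3 → V} (hF : IsEquivInv ρ F) (hξ : IsTorusSemi ξ F) {e : Fin 3 → ℤ}
    (he : ¬ Monotone e) : F (dg e) = 0 := by
  set σ := Tuple.sort e with hσ
  obtain ⟨hmono, htie⟩ := Tuple.eq_sort_iff.mp hσ
  have hσ1 : σ ≠ 1 := fun h => he (Tuple.sort_eq_refl_iff_monotone.mp (hσ.symm.trans h))
  have hfix : ∀ (i j : Fin 3) (hij : i < j) (x : ZMod p),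
      ρ (elemGL (σ.injective.ne hij.ne) x) (F (dg e)) = F (dg e) := by
    intro i j hij x
    obtain ⟨y, rfl⟩ := ZMod.ringHom_surjective (PadicInt.toZMod (p := p)) x
    have hle : e (σ i) ≤ e (σ j) := hmono hij.le
    have hu : elemGL (σ.injective.ne hij.ne) ((p : ℚ_[p]) ^ (e (σ j) - e (σ i)) * y) ∈ I1 p := by
      refine elemGL_mem_I1 _ (norm_p_zpow_mul_le (by omega) (PadicInt.norm_le_one y)) fun hlt => ?_
      refine norm_p_zpow_mul_lt (sub_pos.mpr (lt_of_le_of_ne hle fun heq => ?_))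
        (PadicInt.norm_le_one y)
      exact lt_asymm hlt (htie i j hij heq)
    have hred : redM p 3 (elemGL (σ.injective.ne hij.ne) y) =
        elemGL (σ.injective.ne hij.ne) (PadicInt.toZMod y) := elemGL_map _ _ _
    rw [← hred, ← hF.iotaM_mul, ← elemGL_coe]
    refine Eq.trans (congrArg F (Eq.symm ?_)) (hF.2 _ hu (dg e))
    rw [← mul_inv_eq_iff_eq_mul, dg_conj_elemGL, ← mul_assoc, ← zpow_add₀ prime_ne_zero,
      sub_add_sub_cancel, sub_self, zpow_zero, one_mul]
  have htor : ∀ d, ρ (torus d) (F (dg e)) = (ξ d : kb p) • F (dg e) := by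
    intro d
    choose y hy using fun i => exists_unit_lift (d i)
    have h := hξ y (dg e)
    rw [dg_mul_torus, hF.iotaM_mul, redM_torus] at h
    simpa only [hy] using h
  by_contra hne
  set w := ρ (permSub σ) (F (dg e)) with hw
  have hw0 : w ≠ 0 := by
    intro h0
    have := congrArg (ρ (permSub σ)⁻¹) h0
    rw [hw, ← rep_mul_apply, inv_mul_cancel, map_one, map_zero] at this
    exact hne this
  have hwU : UFixed ρ w := uFixed_of_elemGL fun i j hij x => by
    have hc := permSub_conj σ (elemGL (σ.injective.ne hij.ne) x) (elemGL hij.ne x) fun k l => by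
      simp [elemGL_apply]
    rw [hw, ← rep_mul_apply, hc, rep_mul_apply, hfix i j hij]
  have hwT : ∀ d, ρ (torus d) w = (ξ (d ∘ ⇑σ⁻¹) : kb p) • w := fun d => by
    have hc := permSub_conj σ (torus (d ∘ ⇑σ⁻¹)) (torus d) fun k l => by
      have hk : σ⁻¹ (σ k) = k := σ.symm_apply_apply k
      simp only [torus, Matrix.diagonal_apply, σ.injective.eq_iff, Function.comp, hk]
    rw [hw, ← rep_mul_apply, hc, rep_mul_apply, htor, map_smul]
  have key := torus_character_unique hirr hv₀ hw0 hU hwU (fun d => (ξ d : kb p))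
    (fun d => (ξ (d ∘ ⇑σ⁻¹) : kb p)) hT hwT
  exact hreg σ hσ1 fun d => Units.ext (congrFun key d).symm

/-- In characteristic `p`, the sum of a function invariant under a fixed-point-free permutation
of order `p` vanishes. -/
lemma sum_eq_zero_of_perm {α : Type*} [Fintype α] (π : Equiv.Perm α) (hπ : π ^ p = 1)
    (hfree : ∀ x, π x ≠ x) (h : α → V) (hh : ∀ x, h (π x) = h x) : ∑ x, h x = 0 := by
  classical
  rw [← Finset.sum_fiberwise_of_maps_to (fun x _ => Finset.mem_image_of_mem h (Finset.mem_univ x))]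
  refine Finset.sum_eq_zero fun v _ => ?_
  rw [Finset.sum_congr rfl fun x hx => (Finset.mem_filter.mp hx).2, Finset.sum_const]
  let τ : Equiv.Perm {x // h x = v} := π.subtypePerm fun x => by rw [hh]
  have hτ : τ ^ p ^ 1 = 1 := by
    ext x
    simp [τ, Equiv.Perm.subtypePerm_pow, hπ]
  have hsupp : τ.supportᶜ = ∅ := by
    ext x
    simp only [Finset.mem_compl, Equiv.Perm.mem_support, not_not, Finset.notMem_empty, iff_false]
    exact fun hx => hfree x (congrArg Subtype.val hx)
  have hcard := Equiv.Perm.card_compl_support_modEq hτ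
  rw [hsupp, Finset.card_empty, Fintype.card_subtype] at hcard
  obtain ⟨k, hk⟩ := (Nat.modEq_zero_iff_dvd.mp hcard.symm)
  rw [hk, ← Nat.cast_smul_eq_nsmul (kb p), Nat.cast_mul, CharP.cast_eq_zero, zero_mul, zero_smul]

lemma conj_elemGL_apply {R : Type*} [CommRing R] {i j : Fin 3} (h : i ≠ j) (x : R) (r : GL (Fin 3) R)
    (k l : Fin 3) : (r⁻¹ * elemGL h x * r : GL (Fin 3) R) k l =
      (if k = l then 1 else 0) + x * ((r⁻¹ : GL (Fin 3) R) k i * r j l) := by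
  have h1 : (r⁻¹ * elemGL h x * r : GL (Fin 3) R).val =
      1 + (r⁻¹ : GL (Fin 3) R).val * Matrix.single i j x * r.val := by
    simp only [Units.val_mul, elemGL, Matrix.transvection, Matrix.mul_add, Matrix.add_mul, mul_one]
    rw [← Units.val_mul, inv_mul_cancel, Units.val_one]
  rw [h1, Matrix.add_apply, Matrix.one_apply, Matrix.mul_apply, Finset.sum_eq_single j]
  · rw [Matrix.mul_single_apply_same]
    ring
  · intro b _ hb
    rw [Matrix.mul_single_apply_of_ne _ _ _ _ _ hb, zero_mul]
  · simp

lemma I1_norm_diag {r : GG p 3} (hr : r ∈ I1 p) (i : Fin 3) : ‖r i i‖ = 1 := by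
  have h := ((mem_I1_iff r).mp hr).2.2 i
  have h2 : ‖r i i - 1‖ ≠ ‖(1 : ℚ_[p])‖ := by
    rw [norm_one]
    exact h.ne
  have h3 := Padic.add_eq_max_of_ne h2
  rw [sub_add_cancel, norm_one, max_eq_right h.le] at h3
  exact h3

/-- A Hecke sum vanishes at increasing exponents when some elementary matrix permutes the cosets
freely. -/
lemma IsEquivInv.heckeSum_dg_eq_zero {f : GG p 3 → V} (hf : IsEquivInv ρ f) {b : Fin 3 → ℤ}
    {R : Finset (GG p 3)} (hR : IsRepSet p 3 (dg b) R) {i j : Fin 3} (hji : j < i)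
    (hij : b j - b i = 1) (hb : ∀ k l, b k - b l ≤ 1) {e : Fin 3 → ℤ} (he : Monotone e) :
    hk p 3 (dg b) R f (dg e) = 0 := by
  have hne : i ≠ j := hji.ne'
  set u : GG p 3 := elemGL hne (p : ℚ_[p]) with hu
  have hnp : ‖(p : ℚ_[p])‖ < 1 := Padic.norm_p_lt_one
  have huI : u ∈ I1 p := elemGL_mem_I1 hne hnp.le fun _ => hnp
  obtain ⟨π, hπ⟩ := hR.exists_perm (fun r => u * r) (fun r hr => (I1 p).mul_mem huI hr)
    (fun r _ r' _ h => by
      have e : r'⁻¹ * r = (u * r')⁻¹ * (u * r) := by group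
      rw [e]
      exact h)
  have hpow : ∀ (n : ℕ) (r : R), ((π ^ n) r : GG p 3)⁻¹ * (u ^ n * r) ∈ stabI1 (dg b) := by
    intro n
    induction n with
    | zero =>
      intro r
      simp [(stabI1 (dg b)).one_mem]
    | succ n ih =>
      intro r
      have h := (stabI1 (dg b)).mul_mem (ih (π r)) (?_ : ((π r : GG p 3))⁻¹ * (u * r) ∈ _)
      · rw [pow_succ, pow_succ, Equiv.Perm.mul_apply]
        convert h using 1
        group
      · exact hπ r
  have hup : ∀ r ∈ I1 p, r⁻¹ * (u ^ p * r) ∈ stabI1 (dg b) := by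
    intro r hr
    have hupI : u ^ p ∈ I1 p := (I1 p).pow_mem huI p
    refine mem_stabI1.mpr ⟨(I1 p).mul_mem ((I1 p).inv_mem hr) ((I1 p).mul_mem hupI hr), ?_⟩
    have hsmall : ∀ k l, ‖(p : ℚ_[p]) ^ (b k - b l) *
        ((p * p : ℚ_[p]) * ((r⁻¹ : GG p 3) k i * r j l))‖ < 1 := by
      intro k l
      have e1 : (p : ℚ_[p]) ^ (b k - b l) * ((p * p : ℚ_[p]) * ((r⁻¹ : GG p 3) k i * r j l)) =
          (p : ℚ_[p]) ^ (b k - b l + 2) * ((r⁻¹ : GG p 3) k i * r j l) := by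
        rw [zpow_add₀ prime_ne_zero, zpow_ofNat]
        ring
      rw [e1]
      refine norm_p_zpow_mul_lt (by have := hb l k; omega) ?_
      rw [norm_mul]
      exact mul_le_one₀ (((mem_I1_iff _).mp ((I1 p).inv_mem hr)).1 _ _) (norm_nonneg _)
        (((mem_I1_iff _).mp hr).1 _ _)
    have hent : ∀ k l, (dg b * (r⁻¹ * (u ^ p * r)) * (dg b)⁻¹ : GG p 3) k l =
        (if k = l then 1 else 0) + (p : ℚ_[p]) ^ (b k - b l) *
        ((p * p : ℚ_[p]) * ((r⁻¹ : GG p 3) k i * r j l)) := by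
      intro k l
      rw [dg_conj_apply, hu, elemGL_pow, ← mul_assoc r⁻¹, conj_elemGL_apply, mul_add]
      congr 1
      split_ifs with hkl
      · rw [hkl, sub_self, zpow_zero, one_mul]
      · rw [mul_zero]
    rw [mem_I1_iff]
    refine ⟨fun k l => ?_, fun k l hkl => ?_, fun k => ?_⟩
    · rw [hent]
      refine (Padic.nonarchimedean _ _).trans (max_le ?_ (hsmall k l).le)
      split_ifs <;> simp
    · rw [hent, if_neg hkl.ne', zero_add]
      exact hsmall k l
    · rw [hent, if_pos rfl, add_sub_cancel_left]
      exact hsmall k k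
  have hfree : ∀ r, π r ≠ r := by
    intro r h
    have h1 := hπ r
    rw [h, ← mul_assoc] at h1
    have h2 := ((mem_I1_iff _).mp (mem_stabI1.mp h1).2).2.1 i j hji
    have e : b i - b j = -1 := by omega
    have hr := hR.mem_I1 r.2
    rw [dg_conj_apply, conj_elemGL_apply, if_neg hne, zero_add, e, _root_.zpow_neg_one, ← mul_assoc,
      inv_mul_cancel₀ prime_ne_zero, one_mul, norm_mul, I1_norm_diag ((I1 p).inv_mem hr),
      I1_norm_diag hr, one_mul] at h2
    exact lt_irrefl _ h2
  have hord : π ^ p = 1 := by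
    refine Equiv.ext fun r => Subtype.ext (hR.eq_of_mem r.2 ((π ^ p) r).2 ?_).symm
    have h := (stabI1 (dg b)).mul_mem (hpow p r)
      ((stabI1 (dg b)).inv_mem (hup r (hR.mem_I1 r.2)))
    convert h using 1
    group
  simp only [hk]
  rw [← Finset.sum_coe_sort R]
  refine sum_eq_zero_of_perm π hord hfree (fun r : R => f (dg e * (r : GG p 3) * (dg b)⁻¹)) fun r => ?_
  have h1 := hf.stab_inv (dg b) (dg e) (π r) _ (hπ r)
  rw [mul_inv_cancel_left] at h1
  rw [← h1]
  have hle := he hji.le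
  obtain ⟨n, hn⟩ := Int.eq_ofNat_of_zero_le (sub_nonneg.mpr hle)
  have hK : dg e * u * (dg e)⁻¹ = iotaM p 3 (elemGL hne ((p : ℤ_[p]) ^ (n + 1))) := by
    rw [hu, dg_conj_elemGL, ← elemGL_coe, hn, PadicInt.coe_pow, PadicInt.coe_natCast, pow_succ,
      zpow_natCast]
  have hred : redM p 3 (elemGL hne ((p : ℤ_[p]) ^ (n + 1))) = 1 := by
    refine (elemGL_map _ _ _).trans ?_
    refine Units.ext ?_
    simp [elemGL]
  have hx : dg e * (u * (r : GG p 3)) * (dg b)⁻¹ = iotaM p 3 (elemGL hne ((p : ℤ_[p]) ^ (n + 1))) *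
      (dg e * (r : GG p 3) * (dg b)⁻¹) := by
    rw [← hK]
    group
  rw [hx, hf.iotaM_mul, hred, map_one]
  rfl

end Vanishing

section Decomposition

variable {p}

/-- The unipotent matrix `1 + ∑ₖ vₖ E_{kj}` for a vector `v` with `v j = 0`. -/
def colGL {R : Type*} [CommRing R] {j : Fin 3} {v : Fin 3 → R} (hv : v j = 0) : GL (Fin 3) R where
  val := 1 + Matrix.vecMulVec v (Pi.single j 1)
  inv := 1 - Matrix.vecMulVec v (Pi.single j 1)
  val_inv := by
    have h : Matrix.vecMulVec v (Pi.single j 1) * Matrix.vecMulVec v (Pi.single j 1) = 0 := by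
      rw [Matrix.vecMulVec_mul_vecMulVec]
      simp [hv]
    simp [Matrix.add_mul, Matrix.mul_sub, h]
  inv_val := by
    have h : Matrix.vecMulVec v (Pi.single j 1) * Matrix.vecMulVec v (Pi.single j 1) = 0 := by
      rw [Matrix.vecMulVec_mul_vecMulVec]
      simp [hv]
    simp [Matrix.sub_mul, Matrix.mul_add, h]

lemma colGL_apply {R : Type*} [CommRing R] {j : Fin 3} {v : Fin 3 → R} (hv : v j = 0)
    (k l : Fin 3) : colGL hv k l = (if k = l then 1 else 0) + if l = j then v k else 0 := by
  simp [colGL, Matrix.one_apply, Matrix.vecMulVec_apply, Pi.single_apply]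

lemma colGL_mul_apply {R : Type*} [CommRing R] {j : Fin 3} {v : Fin 3 → R} (hv : v j = 0)
    (y : GL (Fin 3) R) (k l : Fin 3) : (colGL hv * y : GL (Fin 3) R) k l = y k l + v k * y j l := by
  simp [Matrix.mul_apply, colGL_apply, add_mul, Finset.sum_add_distrib]

/-- The unipotent matrix `1 + ∑ₗ wₗ E_{jl}` for a vector `w` with `w j = 0`. -/
def rowGL {R : Type*} [CommRing R] {j : Fin 3} {w : Fin 3 → R} (hw : w j = 0) : GL (Fin 3) R where
  val := 1 + Matrix.vecMulVec (Pi.single j 1) w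
  inv := 1 - Matrix.vecMulVec (Pi.single j 1) w
  val_inv := by
    have h : Matrix.vecMulVec (Pi.single j 1) w * Matrix.vecMulVec (Pi.single j 1) w = 0 := by
      rw [Matrix.vecMulVec_mul_vecMulVec]
      simp [hw]
    simp [Matrix.add_mul, Matrix.mul_sub, h]
  inv_val := by
    have h : Matrix.vecMulVec (Pi.single j 1) w * Matrix.vecMulVec (Pi.single j 1) w = 0 := by
      rw [Matrix.vecMulVec_mul_vecMulVec]
      simp [hw]
    simp [Matrix.sub_mul, Matrix.mul_add, h]

lemma rowGL_apply {R : Type*} [CommRing R] {j : Fin 3} {w : Fin 3 → R} (hw : w j = 0)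
    (k l : Fin 3) : rowGL hw k l = (if k = l then 1 else 0) + if k = j then w l else 0 := by
  simp [rowGL, Matrix.one_apply, Matrix.vecMulVec_apply, Pi.single_apply]

lemma mul_rowGL_apply {R : Type*} [CommRing R] {j : Fin 3} {w : Fin 3 → R} (hw : w j = 0)
    (y : GL (Fin 3) R) (k l : Fin 3) : (y * rowGL hw : GL (Fin 3) R) k l = y k l + y k j * w l := by
  simp [Matrix.mul_apply, rowGL_apply, mul_add, Finset.sum_add_distrib]

lemma permSub_mul_apply {R : Type*} [CommRing R] (σ : Equiv.Perm (Fin 3)) (y : GL (Fin 3) R)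
    (k l : Fin 3) : (permSub σ * y : GL (Fin 3) R) k l = y (σ k) l := by
  simp [Matrix.mul_apply, permSub, Matrix.one_apply]

lemma permSub_map (σ : Equiv.Perm (Fin 3)) : iotaM p 3 (permSub σ) = permSub σ := by
  refine Units.ext (Matrix.ext fun i j => ?_)
  rw [iotaM_apply]
  simp only [permSub, Matrix.submatrix_apply, Matrix.one_apply, id]
  split_ifs <;> simp

lemma colGL_mem_range {j : Fin 3} {v : Fin 3 → ℚ_[p]} (hv : v j = 0) (h : ∀ k, ‖v k‖ ≤ 1) :
    colGL hv ∈ (iotaM p 3).range := by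
  let v' : Fin 3 → ℤ_[p] := fun k => ⟨v k, h k⟩
  have hv' : v' j = 0 := PadicInt.ext hv
  refine ⟨colGL hv', Units.ext (Matrix.ext fun k l => ?_)⟩
  rw [iotaM_apply, colGL_apply, colGL_apply, PadicInt.coe_add]
  split_ifs <;> simp [v']

lemma rowGL_mem_I1 {j : Fin 3} {w : Fin 3 → ℚ_[p]} (hw : w j = 0) (h : ∀ l, ‖w l‖ ≤ 1)
    (hlt : ∀ l < j, ‖w l‖ < 1) : rowGL hw ∈ I1 p := by
  rw [mem_I1_iff]
  refine ⟨fun k l => ?_, fun k l hkl => ?_, fun k => ?_⟩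
  · rw [rowGL_apply]
    refine (Padic.nonarchimedean _ _).trans (max_le ?_ ?_)
    · split_ifs <;> simp
    · split_ifs
      · exact h l
      · simp
  · rw [rowGL_apply, if_neg hkl.ne', zero_add]
    split_ifs with hk
    · exact hlt l (hk ▸ hkl)
    · simp
  · rw [rowGL_apply, if_pos rfl, add_sub_cancel_left]
    split_ifs with hk
    · simp [hk, hw]
    · simp

/-- The rows and columns of `x` indexed by `C` vanish off the diagonal. -/
def IsCleared (C : Finset (Fin 3)) (x : GG p 3) : Prop :=
  ∀ i ∈ C, ∀ j, j ≠ i → x i j = 0 ∧ x j i = 0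

lemma exists_row_ne_zero (x : GG p 3) (i : Fin 3) : ∃ j, x i j ≠ 0 := by
  by_contra! h
  have hd : x.val.det = 0 := Matrix.det_eq_zero_of_row_eq_zero i h
  have := (GeneralLinearGroup.det x).ne_zero
  rw [GeneralLinearGroup.val_det_apply] at this
  exact this hd

/-- One step of elimination: a further row and column can be cleared. -/
lemma IsCleared.step {C : Finset (Fin 3)} {x : GG p 3} (hx : IsCleared C x) (hC : C ≠ Finset.univ) :
    ∃ j ∉ C, ∃ k ∈ (iotaM p 3).range, ∃ u ∈ I1 p, IsCleared (insert j C) (k * x * u) := by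
  obtain ⟨i₀, hi₀⟩ : ∃ i, i ∉ C := by
    by_contra! h
    exact hC (Finset.eq_univ_of_forall h)
  obtain ⟨⟨i, j⟩, hij, hmax⟩ := Finset.exists_max_image (Cᶜ ×ˢ Cᶜ)
    (fun q : Fin 3 × Fin 3 => toLex (‖x q.1 q.2‖, OrderDual.toDual q.2)) ⟨(i₀, i₀), by simp [hi₀]⟩
  simp only [Finset.mem_product, Finset.mem_compl] at hij hmax
  obtain ⟨hi, hj⟩ := hij
  have hle : ∀ k l, k ∉ C → l ∉ C → ‖x k l‖ ≤ ‖x i j‖ := fun k l hk hl => by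
    rcases Prod.Lex.le_iff.mp (hmax (k, l) ⟨hk, hl⟩) with h | h
    · exact h.le
    · exact h.1.le
  have hlt : ∀ k l, k ∉ C → l ∉ C → l < j → ‖x k l‖ < ‖x i j‖ := fun k l hk hl hlj => by
    rcases Prod.Lex.le_iff.mp (hmax (k, l) ⟨hk, hl⟩) with h | h
    · exact h
    · exact absurd (OrderDual.toDual_le_toDual.mp h.2) (not_le.mpr hlj)
  have hne : x i j ≠ 0 := by
    intro h0
    obtain ⟨l, hl⟩ := exists_row_ne_zero x i₀
    by_cases hlC : l ∈ C
    · exact hl (hx l hlC i₀ fun h => hi₀ (h ▸ hlC)).2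
    · have := hle i₀ l hi₀ hlC
      rw [h0, norm_zero] at this
      exact hl (norm_le_zero_iff.mp this)
  set y : GG p 3 := permSub (Equiv.swap j i) * x with hy
  have hyx : ∀ k l, y k l = x (Equiv.swap j i k) l := permSub_mul_apply _ x
  have hswap : ∀ k ∉ C, Equiv.swap j i k ∉ C := fun k hk => by
    rw [Equiv.swap_apply_def]
    split_ifs <;> assumption
  have hswap' : ∀ k ∈ C, Equiv.swap j i k = k := fun k hk =>
    Equiv.swap_apply_of_ne_of_ne (fun h => hj (h ▸ hk)) fun h => hi (h ▸ hk)
  have hyjj : y j j = x i j := by rw [hyx, Equiv.swap_apply_left]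
  have hyC : IsCleared C y := by
    intro k hk l hl
    rw [hyx, hyx, hswap' k hk]
    refine ⟨(hx k hk l hl).1, (hx k hk _ fun h => hl ?_).2⟩
    rw [← hswap' k hk] at h
    exact (Equiv.swap j i).injective h
  have hy0 : y j j ≠ 0 := hyjj ▸ hne
  have hylt : ∀ l < j, ‖y j l‖ < ‖y j j‖ := fun l hl => by
    by_cases hlC : l ∈ C
    · rw [(hyC l hlC j fun h => hj (h ▸ hlC)).2, norm_zero]
      exact norm_pos_iff.mpr hy0
    · rw [hyjj, hyx]
      exact hlt _ l (hswap j hj) hlC hl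
  have hyle : ∀ k l, k = j ∨ l = j → ‖y k l‖ ≤ ‖y j j‖ := fun k l hkl => by
    by_cases hC : k ∈ C ∨ l ∈ C
    · have h0 : y k l = 0 := by
        rcases hkl with rfl | rfl
        · have hl := hC.resolve_left hj
          exact (hyC l hl k fun h => hj (h ▸ hl)).2
        · have hk := hC.resolve_right hj
          exact (hyC k hk l fun h => hj (h ▸ hk)).1
      rw [h0, norm_zero]
      exact norm_nonneg _
    · rw [not_or] at hC
      rw [hyjj, hyx]
      exact hle _ l (hswap k hC.1) hC.2
  let v : Fin 3 → ℚ_[p] := fun k => if k = j then 0 else -(y k j / y j j)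
  let w : Fin 3 → ℚ_[p] := fun l => if l = j then 0 else -(y j l / y j j)
  have hv : v j = 0 := if_pos rfl
  have hw : w j = 0 := if_pos rfl
  have hvn : ∀ k, ‖v k‖ ≤ 1 := fun k => by
    simp only [v]
    split_ifs
    · simp
    · rw [norm_neg, norm_div]
      exact div_le_one_of_le₀ (hyle k j (Or.inr rfl)) (norm_nonneg _)
  have hwn : ∀ l, ‖w l‖ ≤ 1 := fun l => by
    simp only [w]
    split_ifs
    · simp
    · rw [norm_neg, norm_div]
      exact div_le_one_of_le₀ (hyle j l (Or.inl rfl)) (norm_nonneg _)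
  have hwlt : ∀ l < j, ‖w l‖ < 1 := fun l hl => by
    simp only [w]
    rw [if_neg hl.ne, norm_neg, norm_div, div_lt_one (norm_pos_iff.mpr hy0)]
    exact hylt l hl
  refine ⟨j, hj, colGL hv * permSub (Equiv.swap j i), (iotaM p 3).range.mul_mem
    (colGL_mem_range hv hvn) ⟨_, permSub_map _⟩, rowGL hw, rowGL_mem_I1 hw hwn hwlt, ?_⟩
  rw [mul_assoc (colGL hv), ← hy]
  have hz : ∀ k l, (colGL hv * y * rowGL hw : GG p 3) k l =
      (y k l + v k * y j l) + (y k j + v k * y j j) * w l := fun k l => by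
    rw [mul_rowGL_apply, colGL_mul_apply, colGL_mul_apply]
  intro k hk l hlk
  rw [hz, hz]
  rcases Finset.mem_insert.mp hk with rfl | hk
  · simp only [v, w, if_neg hlk, if_pos]
    constructor <;> field_simp <;> ring
  · have hkj : j ≠ k := fun h => hj (h ▸ hk)
    have h1 := hyC k hk l hlk
    have h2 := hyC k hk j hkj
    have hvk : v k = 0 := by simp [v, hkj.symm, h2]
    have hwk : w k = 0 := by simp [w, hkj.symm, h2]
    simp [h1, h2, hvk, hwk]

lemma IsCleared.exists_diagonal (n : ℕ) : ∀ (C : Finset (Fin 3)), Cᶜ.card = n → ∀ x : GG p 3,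
    IsCleared C x → ∃ k ∈ (iotaM p 3).range, ∃ u ∈ I1 p, IsCleared Finset.univ (k * x * u) := by
  induction n with
  | zero =>
    intro C hC x hx
    rw [Finset.card_eq_zero, Finset.compl_eq_empty_iff] at hC
    subst hC
    exact ⟨1, Subgroup.one_mem _, 1, Subgroup.one_mem _, by simpa using hx⟩
  | succ n ih =>
    intro C hC x hx
    obtain ⟨j, hj, k, hk, u, hu, h⟩ := hx.step (by
      rintro rfl
      simp at hC)
    obtain ⟨k', hk', u', hu', h'⟩ := ih (insert j C) (by
      rw [Finset.compl_insert, Finset.card_erase_of_mem (Finset.mem_compl.mpr hj), hC]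
      rfl) _ h
    refine ⟨k' * k, Subgroup.mul_mem _ hk' hk, u * u', Subgroup.mul_mem _ hu hu', ?_⟩
    convert h' using 1
    group

/-- The group is the union of the double cosets `KZ t_c I_1`. -/
lemma exists_mem_dblCoset (x : GG p 3) : ∃ c, x ∈ dblCoset p c := by
  obtain ⟨k, hk, u, hu, h⟩ := IsCleared.exists_diagonal (p := p) _ ∅ rfl x (by simp [IsCleared])
  set y := k * x * u with hy
  have hdiag : ∀ i, y i i ≠ 0 := fun i h0 => by
    obtain ⟨j, hj⟩ := exists_row_ne_zero y i
    rcases eq_or_ne j i with rfl | hji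
    · exact hj h0
    · exact hj (h i (Finset.mem_univ _) j hji).1
  let e : Fin 3 → ℤ := fun i => (y i i).valuation
  have hunit : ∀ i, ∃ d : ℤ_[p]ˣ, ((d : ℤ_[p]) : ℚ_[p]) = y i i * (p : ℚ_[p]) ^ (-e i) := fun i => by
    have hn : ‖y i i * (p : ℚ_[p]) ^ (-e i)‖ = 1 := by
      rw [norm_mul, Padic.norm_p_zpow, Padic.norm_eq_zpow_neg_valuation (hdiag i), neg_neg,
        ← zpow_add₀ (Nat.cast_ne_zero.mpr (Fact.out : p.Prime).ne_zero)]
      simp [e]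
    exact ⟨PadicInt.mkUnits hn, rfl⟩
  choose d hd using hunit
  have hyd : y = iotaM p 3 (torus d) * dg e := by
    refine Units.ext (Matrix.ext fun i j => ?_)
    rw [mul_dg_apply, iotaM_apply]
    rcases eq_or_ne i j with rfl | hij
    · have : (torus d : MM p 3) i i = d i := by simp [torus]
      rw [this, hd, mul_assoc, ← zpow_add₀ prime_ne_zero, neg_add_cancel, zpow_zero, mul_one]
    · rw [(h i (Finset.mem_univ _) j hij.symm).1]
      simp [torus, Matrix.diagonal_apply_ne _ hij]
  obtain ⟨m, rfl⟩ := hk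
  refine ⟨![e 0 - e 2, e 1 - e 2], e 2, m⁻¹ * torus d, u⁻¹, Subgroup.inv_mem _ hu, ?_⟩
  have he : dg e = piSc p 3 (e 2) * tGL p 3 ![e 0 - e 2, e 1 - e 2] := by
    rw [tGL_eq, expo_eq, piSc_eq, ← dg_add]
    congr 1
    funext i
    fin_cases i <;> simp
  have hx : x = (iotaM p 3 m)⁻¹ * y * u⁻¹ := by
    rw [hy]
    group
  rw [hx, hyd, he, map_mul, map_inv, mul_assoc _ _ (tGL p 3 _), piSc_mul_comm, piSc_mul_comm]
  simp only [mul_assoc]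

variable {V : Type} [AddCommGroup V] [Module (kb p) V]
  {ρ : Representation (kb p) (Gk p 3) V}

lemma IsEquivInv.eq_zero {F : GG p 3 → V} (hF : IsEquivInv ρ F) (h : ∀ c, F (tGL p 3 c) = 0) :
    F = 0 := by
  funext x
  obtain ⟨c, n, m, u, hu, rfl⟩ := exists_mem_dblCoset x
  rw [hF.apply _ _ _ hu, h, map_zero]
  rfl

end Decomposition

section Standard

variable {p}

lemma iotaM_mem_Kset (m : MM p 3) : iotaM p 3 m ∈ Kset p 3 := ⟨m, rfl⟩

lemma dg_conj_colGL (e : Fin 3 → ℤ) {j : Fin 3} {v : Fin 3 → ℚ_[p]} (hv : v j = 0) :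
    dg e * colGL hv * (dg e)⁻¹ =
      colGL (v := fun k => (p : ℚ_[p]) ^ (e k - e j) * v k) (j := j) (by simp [hv]) := by
  refine Units.ext (Matrix.ext fun k l => ?_)
  rw [dg_conj_apply, colGL_apply, colGL_apply, mul_add]
  congr 1
  · split_ifs with h <;> simp [h]
  · split_ifs with h <;> simp [h]

lemma dg_conj_rowGL (e : Fin 3 → ℤ) {j : Fin 3} {w : Fin 3 → ℚ_[p]} (hw : w j = 0) :
    dg e * rowGL hw * (dg e)⁻¹ =
      rowGL (w := fun l => (p : ℚ_[p]) ^ (e j - e l) * w l) (j := j) (by simp [hw]) := by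
  refine Units.ext (Matrix.ext fun k l => ?_)
  rw [dg_conj_apply, rowGL_apply, rowGL_apply, mul_add]
  congr 1
  · split_ifs with h <;> simp [h]
  · split_ifs with h <;> simp [h]

lemma norm_add_lt_one {x y : ℚ_[p]} (hx : ‖x‖ < 1) (hy : ‖y‖ < 1) : ‖x + y‖ < 1 :=
  (Padic.nonarchimedean _ _).trans_lt (max_lt hx hy)

lemma norm_add_le_one {x y : ℚ_[p]} (hx : ‖x‖ ≤ 1) (hy : ‖y‖ ≤ 1) : ‖x + y‖ ≤ 1 :=
  (Padic.nonarchimedean _ _).trans (max_le hx hy)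

lemma norm_sub_lt_one {x y : ℚ_[p]} (hx : ‖x‖ < 1) (hy : ‖y‖ < 1) : ‖x - y‖ < 1 := by
  rw [sub_eq_add_neg]
  exact norm_add_lt_one hx (by rwa [norm_neg])

lemma norm_mul_le_one {x y : ℚ_[p]} (hx : ‖x‖ ≤ 1) (hy : ‖y‖ ≤ 1) : ‖x * y‖ ≤ 1 := by
  rw [norm_mul]
  exact mul_le_one₀ hx (norm_nonneg _) hy

lemma norm_mul_lt_one {x y : ℚ_[p]} (hx : ‖x‖ < 1) (hy : ‖y‖ ≤ 1) : ‖x * y‖ < 1 := by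
  rw [norm_mul]
  exact mul_lt_one_of_nonneg_of_lt_one_left (norm_nonneg _) hx hy

lemma norm_sub_eq_one {x y : ℚ_[p]} (hx : ‖x‖ = 1) (hy : ‖y‖ < 1) : ‖x - y‖ = 1 := by
  have h : ‖x‖ ≠ ‖-y‖ := by
    rw [norm_neg, hx]
    exact hy.ne'
  rw [sub_eq_add_neg, Padic.add_eq_max_of_ne h, norm_neg, hx, max_eq_left hy.le]

/-- Membership of a diagonal conjugate in the pro-`p` Iwahori subgroup is governed by the entries
above the diagonal. -/
lemma dg_conj_mem_I1 {b : Fin 3 → ℤ} (hb : Monotone b) {r : GG p 3} (hr : r ∈ I1 p)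
    (h : ∀ i j, i < j → ‖(dg b * r * (dg b)⁻¹ : GG p 3) i j‖ ≤ 1) :
    dg b * r * (dg b)⁻¹ ∈ I1 p := by
  obtain ⟨h1, h2, h3⟩ := (mem_I1_iff r).mp hr
  have hlow : ∀ i j, j < i → ‖(dg b * r * (dg b)⁻¹ : GG p 3) i j‖ < 1 := fun i j hij => by
    rw [dg_conj_apply]
    exact norm_p_zpow_mul_lt' (sub_nonneg.mpr (hb hij.le)) (h2 i j hij)
  have hdiag : ∀ i, (dg b * r * (dg b)⁻¹ : GG p 3) i i = r i i := fun i => by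
    rw [dg_conj_apply, sub_self, zpow_zero, one_mul]
  refine (mem_I1_iff _).mpr ⟨fun i j => ?_, hlow, fun i => ?_⟩
  · rcases lt_trichotomy i j with hij | rfl | hij
    · exact h i j hij
    · rw [hdiag]
      exact h1 i i
    · exact (hlow i j hij).le
  · rw [hdiag]
    exact h3 i

/-- The inverse conjugate of an element of the pro-`p` Iwahori subgroup lies in it when the
entries below the diagonal stay small. -/
lemma dg_inv_conj_mem_I1 {b : Fin 3 → ℤ} (hb : Monotone b) {r : GG p 3} (hr : r ∈ I1 p)
    (h : ∀ i j, j < i → b j = b i ∨ r i j = 0) : (dg b)⁻¹ * r * dg b ∈ I1 p := by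
  obtain ⟨h1, h2, h3⟩ := (mem_I1_iff r).mp hr
  have hent : ∀ i j, ((dg b)⁻¹ * r * dg b : GG p 3) i j = (p : ℚ_[p]) ^ (b j - b i) * r i j := by
    intro i j
    have := dg_conj_apply (p := p) (-b) r i j
    rw [dg_neg, inv_inv] at this
    rw [this, Pi.neg_apply, Pi.neg_apply]
    congr 2
    ring
  have hlow : ∀ i j, j < i → ‖((dg b)⁻¹ * r * dg b : GG p 3) i j‖ < 1 := fun i j hij => by
    rw [hent]
    rcases h i j hij with h | h
    · rw [h, sub_self, zpow_zero, one_mul]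
      exact h2 i j hij
    · simp [h]
  refine (mem_I1_iff _).mpr ⟨fun i j => ?_, hlow, fun i => ?_⟩
  · rcases le_or_gt i j with hij | hij
    · rw [hent]
      exact norm_p_zpow_mul_le (sub_nonneg.mpr (hb hij)) (h1 i j)
    · exact (hlow i j hij).le
  · rw [hent, sub_self, zpow_zero, one_mul]
    exact h3 i

variable {V : Type} [AddCommGroup V] [Module (kb p) V]
  {ρ : Representation (kb p) (Gk p 3) V}

/-- The value of a Hecke sum at the shifted diagonal matrix. -/
lemma IsEquivInv.heckeSum_apply {f : GG p 3 → V} (hf : IsEquivInv ρ f) {a : Fin 2 → ℤ}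
    (hs : ∀ x, f x ≠ 0 → x ∈ dblCoset p a) {b : Fin 3 → ℤ} (hb : Monotone b) {R : Finset (GG p 3)}
    (hR : IsRepSet p 3 (dg b) R)
    (hint : ∀ r ∈ I1 p, ∀ u ∈ I1 p,
      (∀ i j, i ≤ j → ‖(dg b * r * (dg b)⁻¹ * u⁻¹ : GG p 3) i j‖ ≤ 1) →
      ∀ i j, i < j → ‖(dg b * r * (dg b)⁻¹ : GG p 3) i j‖ ≤ 1)
    (ha : Monotone (expo 3 a)) : hk p 3 (dg b) R f (dg (expo 3 a + b)) = f (tGL p 3 a) := by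
  have hterm : ∀ r, dg (expo 3 a + b) * r * (dg b)⁻¹ = tGL p 3 a * (dg b * r * (dg b)⁻¹) := by
    intro r
    rw [dg_add, tGL_eq]
    group
  obtain ⟨r₀, hr₀, h₀⟩ := hR.exists_rep (I1 p).one_mem
  rw [mul_one, inv_mem_iff] at h₀
  simp only [hk, hterm]
  rw [Finset.sum_eq_single r₀ _ fun h => absurd hr₀ h, hf.2 _ (mem_stabI1.mp h₀).2]
  intro r hr hne
  by_contra h
  have hrI := hR.mem_I1 hr
  obtain ⟨n, m, u, hu, he⟩ := hs _ h
  have hn : n = 0 := by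
    have hd := congrArg (fun g : GG p 3 => ‖(GeneralLinearGroup.det g : ℚ_[p])‖) he
    have hrd := ((mem_Kset_iff r).mp (I1_le_Kset hrI)).2
    have hud := ((mem_Kset_iff u).mp (I1_le_Kset hu)).2
    have ht : ‖(GeneralLinearGroup.det (tGL p 3 a) : ℚ_[p])‖ ≠ 0 :=
      norm_ne_zero_iff.mpr (Units.ne_zero _)
    have hbd : ‖(GeneralLinearGroup.det (dg b : GG p 3) : ℚ_[p])‖ ≠ 0 :=
      norm_ne_zero_iff.mpr (Units.ne_zero _)
    simp only [map_mul, map_inv, Units.val_mul, norm_mul, hrd, hud, norm_det_iotaM, mul_one,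
      Units.val_inv_eq_inv_val, norm_inv, mul_inv_cancel₀ hbd] at hd
    have h1 := mul_right_cancel₀ ht ((one_mul _).trans hd)
    rw [piSc_eq, norm_det_dg, eq_comm, zpow_eq_one_iff_right₀ (by positivity)
      (by exact_mod_cast (Fact.out : p.Prime).ne_one)] at h1
    omega
  have h0 : piSc p 3 0 = 1 := (piSc_eq 0).trans dg_zero
  rw [hn, h0, one_mul] at he
  have hm : dg b * r * (dg b)⁻¹ * u⁻¹ = (tGL p 3 a)⁻¹ * iotaM p 3 m * tGL p 3 a := by
    calc _ = (tGL p 3 a)⁻¹ * (tGL p 3 a * (dg b * r * (dg b)⁻¹)) * u⁻¹ := by group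
      _ = _ := by rw [he]; group
  have hmem := dg_conj_mem_I1 hb hrI (hint r hrI u hu fun i j hij => by
    have hent := dg_conj_apply (p := p) (-expo 3 a) (iotaM p 3 m) i j
    rw [dg_neg, inv_inv, ← tGL_eq] at hent
    rw [hm, hent]
    refine norm_p_zpow_mul_le ?_ (((mem_Kset_iff _).mp (iotaM_mem_Kset m)).1 i j)
    have := ha hij
    rw [Pi.neg_apply, Pi.neg_apply]
    omega)
  refine hne (hR.eq_of_mem hr hr₀ ?_)
  exact (stabI1 _).mul_mem ((stabI1 _).inv_mem h₀) (mem_stabI1.mpr ⟨hrI, hmem⟩)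

/-- The support of a Hecke sum. -/
lemma mem_dblCoset_of_heckeSum_ne_zero {W : Type} [AddCommGroup W] {f : GG p 3 → W} {a c : Fin 2 → ℤ}
    (hs : ∀ x, f x ≠ 0 → x ∈ dblCoset p a) {b : Fin 3 → ℤ} {R : Finset (GG p 3)}
    (hR : IsRepSet p 3 (dg b) R) (hc : expo 3 c = expo 3 a + b)
    (hfac : ∀ u ∈ I1 p, ∃ u₁, dg (expo 3 a) * u₁ * (dg (expo 3 a))⁻¹ ∈ (iotaM p 3).range ∧
      (dg b)⁻¹ * (u₁⁻¹ * u) * dg b ∈ I1 p) (x : GG p 3) (hx : hk p 3 (dg b) R f x ≠ 0) :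
    x ∈ dblCoset p c := by
  obtain ⟨r, hr, hne⟩ := Finset.exists_ne_zero_of_sum_ne_zero hx
  obtain ⟨n, m, u, hu, he⟩ := hs _ hne
  obtain ⟨u₁, ⟨k, hk⟩, hu₂⟩ := hfac u hu
  refine ⟨n, m * k, (dg b)⁻¹ * (u₁⁻¹ * u) * dg b * r⁻¹,
    (I1 p).mul_mem hu₂ ((I1 p).inv_mem (hR.mem_I1 hr)), ?_⟩
  rw [mul_inv_eq_iff_eq_mul, ← eq_mul_inv_iff_mul_eq] at he
  rw [he, map_mul, hk, tGL_eq, tGL_eq, hc, dg_add]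
  group

/-- The shift formula for Hecke sums of standard functions. -/
lemma IsEquivInv.heckeSum_eq {f f' : GG p 3 → V} (hf : IsEquivInv ρ f) (hf' : IsEquivInv ρ f')
    {a c : Fin 2 → ℤ} (hs : ∀ x, f x ≠ 0 → x ∈ dblCoset p a)
    (hs' : ∀ x, f' x ≠ 0 → x ∈ dblCoset p c) (hv : f (tGL p 3 a) = f' (tGL p 3 c))
    {b : Fin 3 → ℤ} (hb : Monotone b) {R : Finset (GG p 3)}
    (hR : IsRepSet p 3 (dg b) R) (hc : expo 3 c = expo 3 a + b)
    (ha : Monotone (expo 3 a))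
    (hint : ∀ r ∈ I1 p, ∀ u ∈ I1 p,
      (∀ i j, i ≤ j → ‖(dg b * r * (dg b)⁻¹ * u⁻¹ : GG p 3) i j‖ ≤ 1) →
      ∀ i j, i < j → ‖(dg b * r * (dg b)⁻¹ : GG p 3) i j‖ ≤ 1)
    (hfac : ∀ u ∈ I1 p, ∃ u₁, dg (expo 3 a) * u₁ * (dg (expo 3 a))⁻¹ ∈ (iotaM p 3).range ∧
      (dg b)⁻¹ * (u₁⁻¹ * u) * dg b ∈ I1 p) : hk p 3 (dg b) R f = f' := by
  refine (hf.heckeSum hR).ext_of_supp hf' (mem_dblCoset_of_heckeSum_ne_zero hs hR hc hfac) hs' ?_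
  rw [tGL_eq, hc, hf.heckeSum_apply hs hb hR hint ha, hv, tGL_eq, hc]

/-- The integrality input for the shift by `(-1, 0, 0)`. -/
lemma norm_conj_le_one_first {r u : GG p 3} (hr : r ∈ I1 p) (hu : u ∈ I1 p)
    (h : ∀ i j, i ≤ j → ‖(dg ![-1, 0, 0] * r * (dg ![-1, 0, 0])⁻¹ * u⁻¹ : GG p 3) i j‖ ≤ 1)
    (i j : Fin 3) (hij : i < j) : ‖(dg ![-1, 0, 0] * r * (dg ![-1, 0, 0])⁻¹ : GG p 3) i j‖ ≤ 1 := by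
  rcases eq_or_ne i 0 with rfl | hi
  · set s : GG p 3 := dg ![-1, 0, 0] * r * (dg ![-1, 0, 0])⁻¹
    have hsu : s = s * u⁻¹ * u := by group
    have hrow : ∀ k, ‖(s * u⁻¹ : GG p 3) 0 k‖ ≤ 1 := fun k => h 0 k (Fin.zero_le k)
    have hui := ((mem_I1_iff u).mp hu).1
    rw [hsu, Units.val_mul, Matrix.mul_apply, Fin.sum_univ_three]
    exact norm_add_le_one (norm_add_le_one (norm_mul_le_one (hrow 0) (hui _ _))
      (norm_mul_le_one (hrow 1) (hui _ _))) (norm_mul_le_one (hrow 2) (hui _ _))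
  · have hb : ∀ k : Fin 3, k ≠ 0 → (![-1, 0, 0] : Fin 3 → ℤ) k = 0 := by decide
    rw [dg_conj_apply, hb i hi, hb j (fun h => by simp [h] at hij), sub_self, zpow_zero, one_mul]
    exact ((mem_I1_iff r).mp hr).1 i j

/-- The integrality input for the shift by `(-1, -1, 0)`. -/
lemma norm_conj_le_one_second {r u : GG p 3} (hr : r ∈ I1 p) (hu : u ∈ I1 p)
    (h : ∀ i j, i ≤ j → ‖(dg ![-1, -1, 0] * r * (dg ![-1, -1, 0])⁻¹ * u⁻¹ : GG p 3) i j‖ ≤ 1)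
    (i j : Fin 3) (hij : i < j) :
    ‖(dg ![-1, -1, 0] * r * (dg ![-1, -1, 0])⁻¹ : GG p 3) i j‖ ≤ 1 := by
  have hi2 : i ≠ 2 := by
    rintro rfl
    exact absurd hij (not_lt.mpr (Fin.le_last j))
  have hb : ∀ k : Fin 3, k ≠ 2 → (![-1, -1, 0] : Fin 3 → ℤ) k = -1 := by decide
  have hsmall : ∀ k, k ≠ 2 → ‖(dg ![-1, -1, 0] * r * (dg ![-1, -1, 0])⁻¹ : GG p 3) i k‖ ≤ 1 := by
    intro k hk
    rw [dg_conj_apply, hb i hi2, hb k hk, sub_self, zpow_zero, one_mul]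
    exact ((mem_I1_iff r).mp hr).1 i k
  by_cases hj : j = 2
  · subst hj
    set s : GG p 3 := dg ![-1, -1, 0] * r * (dg ![-1, -1, 0])⁻¹
    clear_value s
    have hw := (I1 p).inv_mem hu
    have hwi := ((mem_I1_iff _).mp hw).1
    have h2 := h i 2 hij.le
    have hsum : s i 2 * u⁻¹ 2 2 = (s * u⁻¹ : GG p 3) i 2 -
        (s i 0 * u⁻¹ 0 2 + s i 1 * u⁻¹ 1 2) := by
      rw [Units.val_mul, Matrix.mul_apply, Fin.sum_univ_three]
      ring
    have hn : ‖s i 2 * u⁻¹ 2 2‖ ≤ 1 := by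
      rw [hsum, sub_eq_add_neg]
      refine norm_add_le_one h2 ?_
      rw [norm_neg]
      exact norm_add_le_one (norm_mul_le_one (hsmall 0 (by decide)) (hwi _ _))
        (norm_mul_le_one (hsmall 1 (by decide)) (hwi _ _))
    rwa [norm_mul, I1_norm_diag hw, mul_one] at hn
  · exact hsmall j hj

/-- The factorization input for the shift by `(-1, 0, 0)`. -/
lemma exists_factor_first {e : Fin 3 → ℤ} (he : Monotone e) {u : GG p 3} (hu : u ∈ I1 p) :
    ∃ u₁, dg e * u₁ * (dg e)⁻¹ ∈ (iotaM p 3).range ∧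
      (dg ![-1, 0, 0])⁻¹ * (u₁⁻¹ * u) * dg ![-1, 0, 0] ∈ I1 p := by
  obtain ⟨h1, h2, h3⟩ := (mem_I1_iff u).mp hu
  have hu0 : ‖u 0 0‖ = 1 := I1_norm_diag hu 0
  have hu00 : u 0 0 ≠ 0 := norm_ne_zero_iff.mp (by simp [hu0])
  let v : Fin 3 → ℚ_[p] := fun k => if k = 0 then 0 else u k 0 / u 0 0
  have hv : v 0 = 0 := if_pos rfl
  have hvn : ∀ k, ‖v k‖ < 1 := fun k => by
    simp only [v]
    split_ifs with hk
    · simp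
    · rw [norm_div, hu0, div_one]
      exact h2 k 0 (Fin.pos_of_ne_zero hk)
  have hvI : colGL hv ∈ I1 p := by
    rw [mem_I1_iff]
    refine ⟨fun k l => ?_, fun k l hkl => ?_, fun k => ?_⟩
    · rw [colGL_apply]
      refine norm_add_le_one ?_ ?_
      · split_ifs <;> simp
      · split_ifs
        · exact (hvn k).le
        · simp
    · rw [colGL_apply, if_neg hkl.ne', zero_add]
      split_ifs
      · exact hvn k
      · simp
    · rw [colGL_apply, if_pos rfl, add_sub_cancel_left]
      split_ifs
      · exact hvn k
      · simp
  refine ⟨colGL hv, ?_, ?_⟩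
  · rw [dg_conj_colGL]
    exact colGL_mem_range _ fun k =>
      norm_p_zpow_mul_le (sub_nonneg.mpr (he (Fin.zero_le k))) (hvn k).le
  · set z := (colGL hv)⁻¹ * u with hz
    have hzu : colGL hv * z = u := by
      rw [hz]
      group
    refine dg_inv_conj_mem_I1 (by
      intro i j hij
      fin_cases i <;> fin_cases j <;> simp at hij ⊢) ((I1 p).mul_mem ((I1 p).inv_mem hvI) hu)
      fun i j hij => ?_
    have hi : i ≠ 0 := fun h => by simp [h] at hij
    rcases eq_or_ne j 0 with rfl | hj
    · right
      have e0 := colGL_mul_apply hv z 0 0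
      have ei := colGL_mul_apply hv z i 0
      rw [hzu, hv, zero_mul, add_zero] at e0
      rw [hzu, ← e0] at ei
      have hvi : v i = u i 0 / u 0 0 := if_neg hi
      rw [hvi, div_mul_cancel₀ _ hu00] at ei
      exact left_eq_add.mp (ei.trans (add_comm _ _))
    · left
      have hb : ∀ k : Fin 3, k ≠ 0 → (![-1, 0, 0] : Fin 3 → ℤ) k = 0 := by decide
      rw [hb i hi, hb j hj]

/-- The factorization input for the shift by `(-1, -1, 0)`. -/
lemma exists_factor_second {e : Fin 3 → ℤ} (he : Monotone e) {u : GG p 3} (hu : u ∈ I1 p) :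
    ∃ u₁, dg e * u₁ * (dg e)⁻¹ ∈ (iotaM p 3).range ∧
      (dg ![-1, -1, 0])⁻¹ * (u₁⁻¹ * u) * dg ![-1, -1, 0] ∈ I1 p := by
  obtain ⟨h1, h2, h3⟩ := (mem_I1_iff u).mp hu
  set D := u 0 0 * u 1 1 - u 1 0 * u 0 1 with hD
  have hDn : ‖D‖ = 1 := norm_sub_eq_one
    (by rw [norm_mul, I1_norm_diag hu, I1_norm_diag hu, one_mul])
    (norm_mul_lt_one (h2 1 0 (by decide)) (h1 0 1))
  have hD0 : D ≠ 0 := norm_ne_zero_iff.mp (by simp [hDn])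
  let w : Fin 3 → ℚ_[p] :=
    ![(u 2 0 * u 1 1 - u 2 1 * u 1 0) / D, (u 2 1 * u 0 0 - u 2 0 * u 0 1) / D, 0]
  have hw : w 2 = 0 := rfl
  have hwn : ∀ k, ‖w k‖ < 1 := fun k => by
    have h20 := h2 2 0 (by decide)
    have h21 := h2 2 1 (by decide)
    have hdiv : ∀ x, ‖x‖ < 1 → ‖x / D‖ < 1 := fun x hx => by rwa [norm_div, hDn, div_one]
    fin_cases k
    · exact hdiv _ (norm_sub_lt_one (norm_mul_lt_one h20 (h1 _ _)) (norm_mul_lt_one h21 (h1 _ _)))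
    · exact hdiv _ (norm_sub_lt_one (norm_mul_lt_one h21 (h1 _ _)) (norm_mul_lt_one h20 (h1 _ _)))
    · simp [w]
  have hwI : rowGL hw ∈ I1 p := rowGL_mem_I1 hw (fun k => (hwn k).le) fun k _ => hwn k
  refine ⟨rowGL hw, ?_, ?_⟩
  · rw [dg_conj_rowGL]
    have hI : rowGL (w := fun l => (p : ℚ_[p]) ^ (e 2 - e l) * w l) (j := 2) (by simp [hw]) ∈
        I1 p := by
      have hn : ∀ l, ‖(p : ℚ_[p]) ^ (e 2 - e l) * w l‖ < 1 := fun l =>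
        norm_p_zpow_mul_lt' (sub_nonneg.mpr (he (Fin.le_last l))) (hwn l)
      exact rowGL_mem_I1 _ (fun l => (hn l).le) fun l _ => hn l
    exact I1_le_Kset hI
  · set z := (rowGL hw)⁻¹ * u with hz
    have hzu : rowGL hw * z = u := by
      rw [hz]
      group
    refine dg_inv_conj_mem_I1 (by
      intro i j hij
      fin_cases i <;> fin_cases j <;> simp at hij ⊢) ((I1 p).mul_mem ((I1 p).inv_mem hwI) hu)
      fun i j hij => ?_
    have hj : j ≠ 2 := by
      rintro rfl
      exact absurd hij (not_lt.mpr (Fin.le_last i))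
    by_cases hi : i = 2
    · right
      subst hi
      have hent : ∀ k l, u k l = z k l + if k = 2 then w 0 * z 0 l + w 1 * z 1 l else 0 := by
        intro k l
        conv_lhs => rw [← hzu]
        rw [Units.val_mul, Matrix.mul_apply, Fin.sum_univ_three]
        simp only [rowGL_apply, hw]
        fin_cases k <;> simp
        ring
      have e0 := hent 0 j
      have e1 := hent 1 j
      have e2 := hent 2 j
      rw [if_neg (by decide), add_zero] at e0 e1
      rw [if_pos rfl, ← e0, ← e1] at e2
      have hkey : u 2 j = w 0 * u 0 j + w 1 * u 1 j := by
        simp only [w, Matrix.cons_val_zero, Matrix.cons_val_one]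
        rw [div_mul_eq_mul_div, div_mul_eq_mul_div, ← add_div, eq_div_iff hD0, hD]
        fin_cases j
        · simp only [Fin.zero_eta]
          ring
        · simp only [Fin.mk_one]
          ring
        · exact absurd rfl hj
      rw [← hkey] at e2
      exact left_eq_add.mp (e2.trans (add_comm _ _))
    · left
      have hb : ∀ k : Fin 3, k ≠ 2 → (![-1, -1, 0] : Fin 3 → ℤ) k = -1 := by decide
      rw [hb i hi, hb j hj]

end Standard

section Final

variable {p}

variable {V : Type} [AddCommGroup V] [Module (kb p) V]
  {ρ : Representation (kb p) (Gk p 3) V}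

lemma wS_one (a : Fin 2 → ℤ) : wS p 3 1 a = tGL p 3 a := by
  have : permGL p 3 1 = 1 := Units.ext (by simp [permGL])
  rw [wS, this, one_mul]

lemma IsStd.isEquivInv {v₀ : V} {a : Fin 2 → ℤ} {f : GG p 3 → V}
    (h : IsStd p 3 ρ v₀ 1 a f) : IsEquivInv ρ f := ⟨h.1.1, h.2.1⟩

lemma IsStd.mem_dblCoset {v₀ : V} {a : Fin 2 → ℤ} {f : GG p 3 → V}
    (h : IsStd p 3 ρ v₀ 1 a f) (x : GG p 3) (hx : f x ≠ 0) : x ∈ dblCoset p a := h.2.2.1 x hx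

lemma IsStd.apply_tGL {v₀ : V} {a : Fin 2 → ℤ} {f : GG p 3 → V}
    (h : IsStd p 3 ρ v₀ 1 a f) : f (tGL p 3 a) = v₀ := by
  rw [← wS_one, h.2.2.2]

lemma uFixed_of_I1pre {v₀ : V} (hfix : ∀ m ∈ I1pre p 3, ρ (redM p 3 m) v₀ = v₀) :
    UFixed ρ v₀ := by
  intro a b c
  obtain ⟨a, rfl⟩ := ZMod.ringHom_surjective (PadicInt.toZMod (p := p)) a
  obtain ⟨b, rfl⟩ := ZMod.ringHom_surjective (PadicInt.toZMod (p := p)) b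
  obtain ⟨c, rfl⟩ := ZMod.ringHom_surjective (PadicInt.toZMod (p := p)) c
  have h : redM p 3 (upperU a b c) =
      upperU (PadicInt.toZMod a) (PadicInt.toZMod b) (PadicInt.toZMod c) := by
    refine Units.ext (Matrix.ext fun i j => ?_)
    rw [redM_apply]
    fin_cases i <;> fin_cases j <;> simp [upperU]
  rw [← h]
  exact hfix _ (mem_I1pre_of_redM h)

lemma torus_smul_of_Ipre {v₀ : V} {ξ : (Fin 3 → (ZMod p)ˣ) →* (kb p)ˣ}
    (hχ : ∀ m ∈ Ipre p 3, ρ (redM p 3 m) v₀ = (ξ (diagOf p 3 m) : kb p) • v₀)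
    (d : Fin 3 → (ZMod p)ˣ) : ρ (torus d) v₀ = (ξ d : kb p) • v₀ := by
  choose y hy using fun i => exists_unit_lift (d i)
  have hred : redM p 3 (torus y) = torus d := by
    rw [redM_torus]
    simp only [hy]
  have hdiag : diagOf p 3 (torus y) = d := by
    funext i
    have h : (redM p 3 (torus y)) i i = d i := by
      rw [hred]
      exact Matrix.diagonal_apply_eq _ i
    rw [diagOf, h, unitOf, dif_neg (d i).ne_zero]
    exact Units.ext rfl
  have h := hχ (torus y) fun i j hij => by
    rw [hred]
    exact Matrix.diagonal_apply_ne _ hij.ne'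
  rwa [hred, hdiag] at h

/-- Hecke sums of standard functions vanish in the non-antidominant directions when the character
is regular. -/
lemma IsStd.heckeSum_eq_zero (hirr : IsIrred p 3 ρ) {v₀ : V} (hv₀ : v₀ ≠ 0)
    (hfix : ∀ m ∈ I1pre p 3, ρ (redM p 3 m) v₀ = v₀) {ξ : (Fin 3 → (ZMod p)ˣ) →* (kb p)ˣ}
    (hχ : ∀ m ∈ Ipre p 3, ρ (redM p 3 m) v₀ = (ξ (diagOf p 3 m) : kb p) • v₀)
    (hreg : ∀ ν : Equiv.Perm (Fin 3), ν ≠ 1 → ¬ (∀ d, ξ (d ∘ ⇑ν⁻¹) = ξ d))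
    {a : Fin 2 → ℤ} {f : GG p 3 → V} (h : IsStd p 3 ρ v₀ 1 a f) {b : Fin 2 → ℤ}
    {R : Finset (GG p 3)} (hR : IsRepSet p 3 (tGL p 3 b) R) {i j : Fin 3} (hji : j < i)
    (hij : expo 3 b j - expo 3 b i = 1) (hb : ∀ k l, expo 3 b k - expo 3 b l ≤ 1) :
    hk p 3 (tGL p 3 b) R f = 0 := by
  have hT := torus_smul_of_Ipre hχ
  have hf := h.isEquivInv
  have hξ : IsTorusSemi ξ f := hf.isTorusSemi h.mem_dblCoset ξ fun d => by
    rw [h.apply_tGL, hT]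
  refine (hf.heckeSum hR).eq_zero fun c => ?_
  by_cases hc : Monotone (expo 3 c)
  · exact hf.heckeSum_dg_eq_zero hR hji hij hb hc
  · exact (hf.heckeSum hR).eq_zero_of_not_monotone hirr hv₀ (uFixed_of_I1pre hfix) hT hreg
      (hξ.heckeSum hf hR) hc

end Final

/-- the regular case for `N = 3`. -/
theorem stmt17 (p : ℕ) [Fact p.Prime]
    {V : Type} [AddCommGroup V] [Module (kb p) V] [FiniteDimensional (kb p) V]
    (ρ : Representation (kb p) (Gk p 3) V) (hirr : IsIrred p 3 ρ)
    (v₀ : V) (hv₀ : v₀ ≠ 0)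
    (hfix : ∀ m ∈ I1pre p 3, ρ (redM p 3 m) v₀ = v₀)
    (ξ : (Fin 3 → (ZMod p)ˣ) →* (kb p)ˣ)
    (hχ : ∀ m ∈ Ipre p 3, ρ (redM p 3 m) v₀ = (ξ (diagOf p 3 m) : kb p) • v₀)
    (hreg : ∀ ν : Equiv.Perm (Fin 3), ν ≠ 1 → ¬ (∀ d, ξ (d ∘ ⇑ν⁻¹) = ξ d)) :
    ∀ a : Fin 2 → ℤ, a ∈ Sset p 3 1 →
      (∀ f f₁ f₂ : GG p 3 → V, IsStd p 3 ρ v₀ 1 a f →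
        IsStd p 3 ρ v₀ 1 ![a 0 - 1, a 1] f₁ → IsStd p 3 ρ v₀ 1 ![a 0 - 1, a 1 - 1] f₂ →
        ∀ R₁ R₂ : Finset (GG p 3),
          IsRepSet p 3 (tGL p 3 ![-1, 0]) R₁ → IsRepSet p 3 (tGL p 3 ![-1, -1]) R₂ →
          (hk p 3 (tGL p 3 ![-1, 0]) R₁ f = f₁ ∧ hk p 3 (tGL p 3 ![-1, -1]) R₂ f = f₂)) ∧
      (∀ f : GG p 3 → V, IsStd p 3 ρ v₀ 1 a f →
        (∀ R : Finset (GG p 3), IsRepSet p 3 (tGL p 3 ![1, 0]) R →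
          hk p 3 (tGL p 3 ![1, 0]) R f = 0) ∧
        (∀ R : Finset (GG p 3), IsRepSet p 3 (tGL p 3 ![0, 1]) R →
          hk p 3 (tGL p 3 ![0, 1]) R f = 0) ∧
        (∀ R : Finset (GG p 3), IsRepSet p 3 (tGL p 3 ![0, -1]) R →
          hk p 3 (tGL p 3 ![0, -1]) R f = 0) ∧
        (∀ R : Finset (GG p 3), IsRepSet p 3 (tGL p 3 ![1, 1]) R →
          hk p 3 (tGL p 3 ![1, 1]) R f = 0)) := by
  intro a ha
  have hmono := monotone_of_mem_Sset ha
  refine ⟨fun f f₁ f₂ hf hf₁ hf₂ R₁ R₂ hR₁ hR₂ => ⟨?_, ?_⟩, fun f hf =>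
    ⟨fun R hR => ?_, fun R hR => ?_, fun R hR => ?_, fun R hR => ?_⟩⟩
  · have hb : tGL p 3 ![-1, 0] = dg ![-1, 0, 0] := by
      rw [tGL_eq, expo_eq]
      rfl
    rw [hb] at hR₁ ⊢
    refine hf.isEquivInv.heckeSum_eq hf₁.isEquivInv hf.mem_dblCoset hf₁.mem_dblCoset
      (hf.apply_tGL.trans hf₁.apply_tGL.symm) ?_ hR₁ ?_ hmono
      (fun r hr u hu => norm_conj_le_one_first hr hu) fun u hu => exists_factor_first hmono hu
    · intro i j hij
      fin_cases i <;> fin_cases j <;> simp at hij ⊢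
    · rw [expo_eq, expo_eq]
      funext i
      fin_cases i <;> simp [sub_eq_add_neg]
  · have hb : tGL p 3 ![-1, -1] = dg ![-1, -1, 0] := by
      rw [tGL_eq, expo_eq]
      rfl
    rw [hb] at hR₂ ⊢
    refine hf.isEquivInv.heckeSum_eq hf₂.isEquivInv hf.mem_dblCoset hf₂.mem_dblCoset
      (hf.apply_tGL.trans hf₂.apply_tGL.symm) ?_ hR₂ ?_ hmono
      (fun r hr u hu => norm_conj_le_one_second hr hu) fun u hu => exists_factor_second hmono hu
    · intro i j hij
      fin_cases i <;> fin_cases j <;> simp at hij ⊢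
    · rw [expo_eq, expo_eq]
      funext i
      fin_cases i <;> simp [sub_eq_add_neg]
  · exact hf.heckeSum_eq_zero hirr hv₀ hfix hχ hreg hR (i := 1) (j := 0) (by decide)
      (by decide) (by decide)
  · exact hf.heckeSum_eq_zero hirr hv₀ hfix hχ hreg hR (i := 2) (j := 1) (by decide)
      (by decide) (by decide)
  · exact hf.heckeSum_eq_zero hirr hv₀ hfix hχ hreg hR (i := 1) (j := 0) (by decide)
      (by decide) (by decide)
  · exact hf.heckeSum_eq_zero hirr hv₀ hfix hχ hreg hR (i := 2) (j := 0) (by decide)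
      (by decide) (by decide)

end IH
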